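/- arXiv:2105.06925 — 3 statements merged into one kernel-verified Lean document; each statement's English description precedes it below -/
import Mathlib

section
/- Let c > 0 be a real number. For every ε > 0 there is a constant C(c, ε) > 0 such that for every natural number m: (i) for every hyperplane H ∈ 𝒞_{3, m^c}, |H ∩ S_{3,m}| ≤ C(c, ε) · m^ε; and (ii) for every pair of distinct hyperplanes H_1, H_2 ∈ 𝒞_{4, m^c}, |H_1 ∩ H_2 ∩ S_{4,m}| ≤ C(c, ε) · m^ε. -/
open Finset

noncomputable section

/-- The set of lattice points on the sphere of radius `√m` in `ℤ^d`. -/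
def latSphere (d m : ℕ) : Set (Fin d → ℤ) := {x | ∑ i, x i ^ 2 = (m : ℤ)}

/-- The hyperplane in `ℝ^d` given by `v₁x₁ + ⋯ + v_d x_d = t` (with integer coefficients). -/
def intHyperplane (d : ℕ) (v : Fin d → ℤ) (t : ℤ) : Set (Fin d → ℝ) :=
  {x | ∑ i, (v i : ℝ) * x i = (t : ℝ)}


theorem aux_fiber (D : ℤ) (hD : 0 < D) (N : ℤ) (hN : 0 < N) (s : Finset (ℤ × ℤ))
    (h1 : ∀ p ∈ s, p.1 ^ 2 + D * p.2 ^ 2 = N)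
    (h2 : ∀ p ∈ s, ∀ q ∈ s, N ∣ 2 * (p.1 * q.2 - q.1 * p.2)) : s.card ≤ 10 := by
  classical
  rcases s.eq_empty_or_nonempty with rfl | ⟨p, hp⟩
  · simp
  have hp1 := h1 p hp
  let f : ℤ × ℤ → ℤ × Bool := fun q =>
    (2 * (p.1 * q.2 - q.1 * p.2) / N, decide (0 ≤ p.1 * q.1 + D * p.2 * q.2))
  have key : ∀ q ∈ s, (p.1 * q.1 + D * p.2 * q.2) ^ 2 + D * (p.1 * q.2 - q.1 * p.2) ^ 2 = N ^ 2 := by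
    intro q hq
    have hq1 := h1 q hq
    calc _ = (p.1 ^ 2 + D * p.2 ^ 2) * (q.1 ^ 2 + D * q.2 ^ 2) := by ring
      _ = _ := by rw [hp1, hq1]; ring
  have hcard : s.card ≤ (Finset.Icc (-2 : ℤ) 2 ×ˢ (Finset.univ : Finset Bool)).card := by
    apply Finset.card_le_card_of_injOn f
    · intro q hq
      have hk := key q hq
      obtain ⟨k, hk2⟩ := h2 p hp q hq
      have hdiv : 2 * (p.1 * q.2 - q.1 * p.2) / N = k := by
        rw [hk2]; exact Int.mul_ediv_cancel_left _ hN.ne'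
      simp only [f, Finset.coe_product, Set.mem_prod, Finset.coe_Icc, Set.mem_Icc, hdiv,
        Finset.coe_univ, Set.mem_univ, and_true]
      have hK : (p.1 * q.2 - q.1 * p.2) ^ 2 ≤ N ^ 2 := by
        nlinarith [sq_nonneg (p.1 * q.1 + D * p.2 * q.2), sq_nonneg (p.1 * q.2 - q.1 * p.2)]
      have hk4 : N ^ 2 * k ^ 2 ≤ N ^ 2 * 4 := by
        have : N ^ 2 * k ^ 2 = 4 * (p.1 * q.2 - q.1 * p.2) ^ 2 := by
          rw [← mul_pow, ← hk2]; ring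
        linarith
      have hk5 : k ^ 2 ≤ 4 := le_of_mul_le_mul_left hk4 (by positivity)
      constructor <;> nlinarith
    · intro q hq r hr hqr
      simp only [f, Prod.mk.injEq, decide_eq_decide] at hqr
      obtain ⟨e1, e2⟩ := hqr
      have hkq := key q hq
      have hkr := key r hr
      obtain ⟨k, hk⟩ := h2 p hp q hq
      obtain ⟨l, hl⟩ := h2 p hp r hr
      rw [hk, hl, Int.mul_ediv_cancel_left _ hN.ne', Int.mul_ediv_cancel_left _ hN.ne'] at e1
      have hK : p.1 * q.2 - q.1 * p.2 = p.1 * r.2 - r.1 * p.2 := by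
        have : 2 * (p.1 * q.2 - q.1 * p.2) = 2 * (p.1 * r.2 - r.1 * p.2) := by rw [hk, hl, e1]
        linarith
      have hS : p.1 * q.1 + D * p.2 * q.2 = p.1 * r.1 + D * p.2 * r.2 := by
        rw [hK] at hkq
        have : (p.1 * q.1 + D * p.2 * q.2) ^ 2 = (p.1 * r.1 + D * p.2 * r.2) ^ 2 := by linarith
        rcases sq_eq_sq_iff_eq_or_eq_neg.1 this with h | h
        · exact h
        · by_cases h0 : 0 ≤ p.1 * q.1 + D * p.2 * q.2
          · have := e2.1 h0; linarith
          · have : ¬ 0 ≤ p.1 * r.1 + D * p.2 * r.2 := fun h' => h0 (e2.2 h')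
            omega
      have ex : N * q.1 = N * r.1 := by
        rw [← hp1]
        linear_combination p.1 * hS - D * p.2 * hK
      have ey : N * q.2 = N * r.2 := by
        rw [← hp1]
        linear_combination p.2 * hS + p.1 * hK
      exact Prod.ext (mul_left_cancel₀ hN.ne' ex) (mul_left_cancel₀ hN.ne' ey)
  simpa using hcard

theorem aux_dvd_two (D g : ℤ) (hD : Squarefree D) (h : g ^ 2 ∣ 4 * D) : g ∣ 2 := by
  rcases Int.even_or_odd g with ⟨k, hk⟩ | ho
  · have : k * k ∣ D := by
      have h4 : 4 * (k * k) ∣ 4 * D := by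
        convert h using 1; rw [hk]; ring
      exact (mul_dvd_mul_iff_left (by norm_num)).1 h4
    have hu := hD k this
    have : g = 2 * k := by omega
    rw [this]
    rcases Int.isUnit_iff.1 hu with h | h <;> rw [h] <;> norm_num
  · have hc : IsCoprime (g ^ 2) (4 : ℤ) := by
      have : IsCoprime g (2 : ℤ) := by
        obtain ⟨k, hk⟩ := ho
        exact ⟨1, -k, by rw [hk]; ring⟩
      have h2 := this.pow (m := 2) (n := 2)
      simpa using h2
    have h3 := hc.dvd_of_dvd_mul_left h
    have := hD g (by rwa [← sq])
    exact this.dvd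

theorem aux_prim (D : ℤ) (hD : 0 < D) (hsq : Squarefree D) (N : ℕ) (hN : 0 < N)
    (s : Finset (ℤ × ℤ))
    (h1 : ∀ p ∈ s, p.1 ^ 2 + D * p.2 ^ 2 = N)
    (h2 : ∀ p ∈ s, IsCoprime p.1 p.2) : s.card ≤ 10 * N.divisors.card := by
  classical
  rcases s.eq_empty_or_nonempty with rfl | ⟨p, hp⟩
  · simp
  have hcop : ∀ q ∈ s, IsCoprime q.2 (N : ℤ) := by
    intro q hq
    rw [← h1 q hq]
    have h : IsCoprime q.2 (q.1 ^ 2) := ((h2 q hq).symm).pow_right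
    have := h.add_mul_left_right (D * q.2)
    have e : q.1 ^ 2 + D * q.2 ^ 2 = q.1 ^ 2 + q.2 * (D * q.2) := by ring
    rwa [e]
  apply Finset.card_le_mul_card_image_of_maps_to
    (f := fun q : ℤ × ℤ => Int.gcd (N : ℤ) (p.1 * q.2 - q.1 * p.2))
  · intro q hq
    rw [Nat.mem_divisors]
    refine ⟨?_, hN.ne'⟩
    exact Int.natCast_dvd_natCast.1 (Int.gcd_dvd_left _ _)
  · intro e he
    have hNe : e ∣ N := (Nat.mem_divisors.1 he).1
    obtain ⟨e', he'⟩ := hNe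
    have he0 : 0 < e := Nat.pos_of_mem_divisors he
    have he'Z : (N : ℤ) = e * e' := by exact_mod_cast he'
    have hfib : ∀ q ∈ s, Int.gcd (N : ℤ) (p.1 * q.2 - q.1 * p.2) = e →
        (e : ℤ) ∣ p.1 * q.2 - q.1 * p.2 ∧ (e' : ℤ) ∣ p.1 * q.2 + q.1 * p.2 := by
      intro q hq hqe
      have hd : (e : ℤ) ∣ p.1 * q.2 - q.1 * p.2 := by
        rw [← hqe]; exact Int.gcd_dvd_right _ _
      refine ⟨hd, ?_⟩
      obtain ⟨u', hu'⟩ := hd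
      have hprod : (N : ℤ) ∣ (p.1 * q.2 - q.1 * p.2) * (p.1 * q.2 + q.1 * p.2) := by
        refine ⟨q.2 ^ 2 - p.2 ^ 2, ?_⟩
        have a := h1 p hp
        have b := h1 q hq
        linear_combination q.2 ^ 2 * a - p.2 ^ 2 * b
      rw [hu', he'Z, mul_assoc] at hprod
      have h3 : (e' : ℤ) ∣ u' * (p.1 * q.2 + q.1 * p.2) :=
        (mul_dvd_mul_iff_left (by exact_mod_cast he0.ne')).1 hprod
      have hc : IsCoprime (e' : ℤ) u' := by
        rw [hu', he'Z, Int.gcd_mul_left] at hqe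
        rw [Int.isCoprime_iff_gcd_eq_one]
        simp only [Int.natAbs_natCast] at hqe
        exact Nat.eq_of_mul_eq_mul_left he0 (by rw [hqe, mul_one])
      exact hc.dvd_of_dvd_mul_left h3
    apply aux_fiber D hD N (by exact_mod_cast hN)
    · intro q hq
      exact h1 q (Finset.mem_filter.1 hq).1
    · intro q hq r hr
      obtain ⟨hq, hqe⟩ := Finset.mem_filter.1 hq
      obtain ⟨hr, hre⟩ := Finset.mem_filter.1 hr
      obtain ⟨a1, a2⟩ := hfib q hq hqe
      obtain ⟨b1, b2⟩ := hfib r hr hre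
      have hpN := hcop p hp
      have hpe : IsCoprime (e : ℤ) p.2 :=
        (hpN.of_isCoprime_of_dvd_right (he'Z ▸ dvd_mul_right _ _)).symm
      have hpe' : IsCoprime (e' : ℤ) p.2 :=
        (hpN.of_isCoprime_of_dvd_right (he'Z ▸ dvd_mul_left _ _)).symm
      have c1 : (e : ℤ) ∣ q.1 * r.2 - r.1 * q.2 := by
        apply hpe.dvd_of_dvd_mul_left
        have := (b1.mul_left q.2).sub (a1.mul_left r.2)
        convert this using 1; ring
      have c2 : (e' : ℤ) ∣ q.1 * r.2 - r.1 * q.2 := by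
        apply hpe'.dvd_of_dvd_mul_left
        have := (a2.mul_left r.2).sub (b2.mul_left q.2)
        convert this using 1; ring
      have hg : (Int.gcd (e : ℤ) e' : ℤ) ∣ 2 := by
        apply aux_dvd_two D _ hsq
        set g : ℤ := (Int.gcd (e : ℤ) e' : ℤ) with hgdef
        have ge : g ∣ e := Int.gcd_dvd_left _ _
        have ge' : g ∣ e' := Int.gcd_dvd_right _ _
        have gN : g ^ 2 ∣ (N : ℤ) := by rw [he'Z, sq]; exact mul_dvd_mul ge ge'
        have hqg : IsCoprime g q.2 :=
          ((hcop q hq).of_isCoprime_of_dvd_right (ge.trans (he'Z ▸ dvd_mul_right _ _))).symm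
        have hpg : IsCoprime g p.2 := hpe.of_isCoprime_of_dvd_left ge
        have g2 : g ∣ 2 * p.1 := by
          apply hqg.dvd_of_dvd_mul_right
          have := (ge.trans a1).add (ge'.trans a2)
          convert this using 1; ring
        have g3 : g ^ 2 ∣ (2 * p.1) ^ 2 := pow_dvd_pow_of_dvd g2 2
        have g4 : g ^ 2 ∣ 4 * D * p.2 ^ 2 := by
          have := (gN.mul_left 4).sub g3
          have e : 4 * D * p.2 ^ 2 = 4 * (N : ℤ) - (2 * p.1) ^ 2 := by rw [← h1 p hp]; ring
          rwa [e]
        exact (hpg.pow (m := 2) (n := 2)).dvd_of_dvd_mul_right g4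
      have c3 : (N : ℤ) ∣ (Int.gcd (e : ℤ) e' : ℤ) * (q.1 * r.2 - r.1 * q.2) := by
        rw [Int.gcd_eq_gcd_ab, he'Z, add_mul]
        obtain ⟨x, hx⟩ := c1
        obtain ⟨y, hy⟩ := c2
        apply Dvd.dvd.add
        · rw [hy]; exact ⟨Int.gcdA e e' * y, by ring⟩
        · rw [hx]; exact ⟨Int.gcdB e e' * x, by ring⟩
      exact c3.trans (mul_dvd_mul_right hg _)

theorem aux_sqfree (D : ℤ) (hD : 0 < D) (hsq : Squarefree D) (N : ℕ) (hN : 0 < N)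
    (s : Finset (ℤ × ℤ))
    (h1 : ∀ p ∈ s, p.1 ^ 2 + D * p.2 ^ 2 = N) :
    s.card ≤ 10 * N.divisors.card * N.divisors.card := by
  classical
  have hsqd : ∀ q ∈ s, (Int.gcd q.1 q.2) ^ 2 ∣ N := by
    intro q hq
    have a : (Int.gcd q.1 q.2 : ℤ) ∣ q.1 := Int.gcd_dvd_left _ _
    have b : (Int.gcd q.1 q.2 : ℤ) ∣ q.2 := Int.gcd_dvd_right _ _
    have : ((Int.gcd q.1 q.2 : ℤ)) ^ 2 ∣ (N : ℤ) := by
      rw [← h1 q hq]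
      exact (pow_dvd_pow_of_dvd a 2).add ((pow_dvd_pow_of_dvd b 2).mul_left D)
    exact_mod_cast this
  apply Finset.card_le_mul_card_image_of_maps_to (f := fun q : ℤ × ℤ => Int.gcd q.1 q.2)
  · intro q hq
    rw [Nat.mem_divisors]
    exact ⟨(Dvd.intro_left _ (sq _).symm).trans (hsqd q hq), hN.ne'⟩
  · intro h hh
    have hh0 : 0 < h := Nat.pos_of_mem_divisors hh
    have hhZ : (h : ℤ) ≠ 0 := by exact_mod_cast hh0.ne'
    by_cases hdvd : h ^ 2 ∣ N
    swap
    · have : s.filter (fun q => Int.gcd q.1 q.2 = h) = ∅ := by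
        rw [Finset.filter_eq_empty_iff]
        intro q hq e
        exact hdvd (e ▸ hsqd q hq)
      rw [this]; simp
    obtain ⟨n, hn⟩ := hdvd
    have hn0 : 0 < n := by
      rcases Nat.eq_zero_or_pos n with h0 | h0
      · rw [h0] at hn; omega
      · exact h0
    have hnZ : (N : ℤ) = h ^ 2 * n := by exact_mod_cast hn
    set t := s.filter (fun q => Int.gcd q.1 q.2 = h) with ht
    have hmul : ∀ q ∈ t, q.1 = h * (q.1 / h) ∧ q.2 = h * (q.2 / h) := by
      intro q hq
      have e := (Finset.mem_filter.1 hq).2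
      constructor
      · exact (Int.mul_ediv_cancel' (e ▸ Int.gcd_dvd_left _ _)).symm
      · exact (Int.mul_ediv_cancel' (e ▸ Int.gcd_dvd_right _ _)).symm
    have hinj : Set.InjOn (fun q : ℤ × ℤ => (q.1 / (h : ℤ), q.2 / (h : ℤ))) t := by
      intro q hq r hr e
      simp only [Prod.mk.injEq] at e
      obtain ⟨a, b⟩ := hmul q hq
      obtain ⟨c, d⟩ := hmul r hr
      exact Prod.ext (by rw [a, c, e.1]) (by rw [b, d, e.2])
    rw [← Finset.card_image_of_injOn hinj]
    refine (aux_prim D hD hsq n hn0 _ ?_ ?_).trans ?_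
    · intro p hp
      obtain ⟨q, hq, rfl⟩ := Finset.mem_image.1 hp
      obtain ⟨a, b⟩ := hmul q hq
      have := h1 q (Finset.mem_filter.1 hq).1
      rw [a, b, hnZ] at this
      apply mul_left_cancel₀ (pow_ne_zero 2 hhZ)
      rw [← this]; ring
    · intro p hp
      obtain ⟨q, hq, rfl⟩ := Finset.mem_image.1 hp
      have e := (Finset.mem_filter.1 hq).2
      rw [Int.isCoprime_iff_gcd_eq_one]
      simp only [← e]
      exact Int.gcd_ediv_gcd_ediv_gcd (by omega)
    · exact Nat.mul_le_mul_left _ (Finset.card_le_card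
        (Nat.divisors_subset_of_dvd hN.ne' ⟨h ^ 2, by rw [hn]; ring⟩))

theorem aux_pell (D : ℤ) (hD : 0 < D) (N : ℕ) (hN : 0 < N) (s : Finset (ℤ × ℤ))
    (h1 : ∀ p ∈ s, p.1 ^ 2 + D * p.2 ^ 2 = N) :
    s.card ≤ 10 * N.divisors.card * N.divisors.card := by
  classical
  obtain ⟨a, b, hab, hsq⟩ := Nat.sq_mul_squarefree D.toNat
  have habZ : (b : ℤ) ^ 2 * a = D := by
    have : ((b ^ 2 * a : ℕ) : ℤ) = D := by rw [hab]; omega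
    exact_mod_cast this
  have hb : (b : ℤ) ≠ 0 := by rintro h; rw [h] at habZ; simp at habZ; omega
  have ha : (0 : ℤ) < a := by
    rcases Nat.eq_zero_or_pos a with h | h
    · rw [h] at habZ; simp at habZ; omega
    · exact_mod_cast h
  have hinj : Set.InjOn (fun q : ℤ × ℤ => (q.1, (b : ℤ) * q.2)) s := by
    intro q hq r hr e
    simp only [Prod.mk.injEq] at e
    exact Prod.ext e.1 (mul_left_cancel₀ hb e.2)
  rw [← Finset.card_image_of_injOn hinj]
  refine aux_sqfree a ha (Int.squarefree_natCast.2 hsq) N hN _ ?_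
  intro p hp
  obtain ⟨q, hq, rfl⟩ := Finset.mem_image.1 hp
  rw [← h1 q hq, ← habZ]; ring

theorem aux_div (δ : ℝ) (hδ : 0 < δ) :
    ∃ C : ℝ, 1 ≤ C ∧ ∀ n : ℕ, 0 < n → (n.divisors.card : ℝ) ≤ C * (n : ℝ) ^ δ := by
  classical
  obtain ⟨P, hP⟩ := exists_nat_ge ((2 : ℝ) ^ (1 / δ))
  have hl2 : 0 < Real.log 2 := Real.log_pos (by norm_num)
  set K : ℝ := max 1 (1 / (δ * Real.log 2)) with hK
  have hK1 : 1 ≤ K := le_max_left _ _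
  have hK2 : 1 ≤ K * (δ * Real.log 2) := by
    have h := le_max_right 1 (1 / (δ * Real.log 2))
    rw [div_le_iff₀ (by positivity)] at h
    exact h
  refine ⟨K ^ P, one_le_pow₀ hK1, ?_⟩
  intro n hn
  rw [Nat.card_divisors hn.ne']
  have hn2 : (n : ℝ) ^ δ = ∏ p ∈ n.primeFactors, ((p : ℝ) ^ (n.factorization p)) ^ δ := by
    rw [Real.finsetProd_rpow _ _ (fun i _ => by positivity)]
    congr 1
    conv_lhs => rw [← Nat.prod_factorization_pow_eq_self hn.ne']
    rw [Finsupp.prod, Nat.support_factorization]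
    push_cast
    rfl
  rw [hn2]
  push_cast
  calc ∏ p ∈ n.primeFactors, ((n.factorization p : ℝ) + 1)
      ≤ ∏ p ∈ n.primeFactors, ((if p < P then K else 1) * ((p : ℝ) ^ (n.factorization p)) ^ δ) := by
        apply Finset.prod_le_prod
        · intro i _; positivity
        · intro p hp
          have hpp := Nat.prime_of_mem_primeFactors hp
          have hp2 : (2 : ℝ) ≤ p := by exact_mod_cast hpp.two_le
          set a := n.factorization p
          have hsw : ((p : ℝ) ^ a) ^ δ = ((p : ℝ) ^ δ) ^ a := by
            rw [← Real.rpow_natCast, ← Real.rpow_mul (by positivity), mul_comm,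
              Real.rpow_mul (by positivity), Real.rpow_natCast]
          split_ifs with hlt
          · have h3 : 1 + (a : ℝ) * (δ * Real.log 2) ≤ ((p : ℝ) ^ a) ^ δ := by
              rw [hsw]
              have h4 : ((2 : ℝ) ^ δ) ^ a ≤ ((p : ℝ) ^ δ) ^ a := by gcongr
              refine le_trans ?_ h4
              have h5 : ((2 : ℝ) ^ δ) ^ a = Real.exp ((a : ℝ) * (δ * Real.log 2)) := by
                rw [Real.rpow_def_of_pos (by norm_num), ← Real.exp_nat_mul]
                ring_nf
              rw [h5]
              linarith [Real.add_one_le_exp ((a : ℝ) * (δ * Real.log 2))]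
            calc (a : ℝ) + 1 ≤ K * (1 + (a : ℝ) * (δ * Real.log 2)) := by
                  have : (a : ℝ) * 1 ≤ a * (K * (δ * Real.log 2)) := by gcongr
                  nlinarith
              _ ≤ _ := by gcongr
          · rw [one_mul, hsw]
            have h6 : (2 : ℝ) ≤ (p : ℝ) ^ δ := by
              have h7 : (2 : ℝ) ^ (1 / δ) ≤ p := hP.trans (by exact_mod_cast not_lt.1 hlt)
              calc (2 : ℝ) = ((2 : ℝ) ^ (1 / δ)) ^ δ := by
                    rw [← Real.rpow_mul (by norm_num), one_div_mul_cancel hδ.ne', Real.rpow_one]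
                _ ≤ _ := by gcongr
            calc (a : ℝ) + 1 ≤ 2 ^ a := by exact_mod_cast (Nat.lt_two_pow_self (n := a))
              _ ≤ _ := by gcongr
    _ = (∏ p ∈ n.primeFactors, (if p < P then K else 1)) *
          ∏ p ∈ n.primeFactors, ((p : ℝ) ^ (n.factorization p)) ^ δ := Finset.prod_mul_distrib
    _ ≤ _ := by
        gcongr
        rw [Finset.prod_ite, Finset.prod_const, Finset.prod_const_one, mul_one]
        apply pow_le_pow_right₀ hK1
        calc _ ≤ (Finset.range P).card := Finset.card_le_card (by
              intro x hx; simp at hx ⊢; exact hx.2)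
          _ = P := by simp

theorem aux_count (δ : ℝ) (hδ : 0 < δ) :
    ∃ C : ℝ, 1 ≤ C ∧ ∀ (D : ℤ) (N : ℤ) (R : ℝ) (s : Finset (ℤ × ℤ)), 0 < D → 1 ≤ R →
      (N : ℝ) ≤ R → (∀ p ∈ s, p.1 ^ 2 + D * p.2 ^ 2 = N) → (s.card : ℝ) ≤ C * R ^ δ := by
  obtain ⟨C, hC1, hC⟩ := aux_div (δ / 2) (by positivity)
  refine ⟨10 * C * C, by nlinarith, ?_⟩
  intro D N R s hD hR hNR hs
  have hRδ : 1 ≤ R ^ δ := Real.one_le_rpow hR hδ.le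
  rcases lt_or_ge 0 N with hN | hN
  · lift N to ℕ using hN.le
    have hN' : 0 < N := by exact_mod_cast hN
    have h1 := aux_pell D hD N hN' s hs
    have h2 := hC N hN'
    have hNR' : (N : ℝ) ≤ R := by simpa using hNR
    have h3 : (N.divisors.card : ℝ) ≤ C * R ^ (δ / 2) := h2.trans (by gcongr)
    calc (s.card : ℝ) ≤ 10 * N.divisors.card * N.divisors.card := by exact_mod_cast h1
      _ ≤ 10 * (C * R ^ (δ / 2)) * (C * R ^ (δ / 2)) := by gcongr
      _ = 10 * C * C * (R ^ (δ / 2) * R ^ (δ / 2)) := by ring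
      _ = _ := by rw [← Real.rpow_add (by linarith), add_halves]
  · have hcard : s.card ≤ 1 := by
      rw [Finset.card_le_one]
      have key : ∀ p ∈ s, p = 0 := by
        intro p hp
        have h := hs p hp
        have a : p.1 ^ 2 = 0 := by nlinarith [sq_nonneg p.1, mul_nonneg hD.le (sq_nonneg p.2)]
        have b : D * p.2 ^ 2 = 0 := by nlinarith [sq_nonneg p.1, mul_nonneg hD.le (sq_nonneg p.2)]
        have b' : p.2 ^ 2 = 0 := (mul_eq_zero.1 b).resolve_left hD.ne'
        exact Prod.ext (pow_eq_zero_iff (two_ne_zero) |>.1 a) (pow_eq_zero_iff (two_ne_zero) |>.1 b')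
      intro p hp q hq
      rw [key p hp, key q hq]
    have : (s.card : ℝ) ≤ 1 := by exact_mod_cast hcard
    have hCC : 1 ≤ 10 * C * C := by nlinarith
    exact this.trans (one_le_mul_of_one_le_of_one_le hCC hRδ)

theorem aux_conic_bound (A B E F G Δ T : ℝ) (hT : 0 ≤ T)
    (hA : |A| ≤ T) (hB : |B| ≤ T) (hE : |E| ≤ T) (hF : |F| ≤ T)
    (hG : |G| ≤ T) (hΔ : |Δ| ≤ 2 * T ^ 2) :
    (A * F - B * E) ^ 2 - Δ * (A * G - E ^ 2) ≤ 8 * T ^ 4 := by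
  have mul_bd : ∀ {x y : ℝ}, |x| ≤ T → |y| ≤ T → |x * y| ≤ T ^ 2 := by
    intro x y hx hy
    rw [abs_mul, sq]; gcongr
  have h1 : |A * F - B * E| ≤ 2 * T ^ 2 :=
    (abs_sub _ _).trans (by linarith [mul_bd hA hF, mul_bd hB hE])
  have h2 : |A * G - E ^ 2| ≤ 2 * T ^ 2 := by
    rw [sq E]
    exact (abs_sub _ _).trans (by linarith [mul_bd hA hG, mul_bd hE hE])
  have h3 : (A * F - B * E) ^ 2 ≤ (2 * T ^ 2) ^ 2 := by
    rw [← sq_abs]; gcongr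
  have h4 : |Δ * (A * G - E ^ 2)| ≤ (2 * T ^ 2) * (2 * T ^ 2) := by
    rw [abs_mul]; gcongr
  have := neg_abs_le (Δ * (A * G - E ^ 2))
  nlinarith

theorem aux_conic (δ : ℝ) (hδ : 0 < δ) :
    ∃ K : ℝ, 1 ≤ K ∧ ∀ (A B C E F G : ℤ) (T : ℝ) (s : Finset (ℤ × ℤ)), 0 < A →
      0 < A * C - B ^ 2 → 1 ≤ T →
      |(A : ℝ)| ≤ T → |(B : ℝ)| ≤ T → |(C : ℝ)| ≤ T → |(E : ℝ)| ≤ T → |(F : ℝ)| ≤ T →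
      |(G : ℝ)| ≤ T →
      (∀ p ∈ s, A * p.1 ^ 2 + 2 * B * p.1 * p.2 + C * p.2 ^ 2 + 2 * E * p.1 + 2 * F * p.2 + G = 0) →
      (s.card : ℝ) ≤ K * (8 * T ^ 4) ^ δ := by
  classical
  obtain ⟨K, hK1, hK⟩ := aux_count δ hδ
  refine ⟨K, hK1, ?_⟩
  intro A B C E F G T s hA hD hT bA bB bC bE bF bG hs
  have hinj : Set.InjOn (fun p : ℤ × ℤ =>
      ((A * C - B ^ 2) * p.2 + (A * F - B * E), A * p.1 + B * p.2 + E)) s := by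
    intro p hp q hq e
    simp only [Prod.mk.injEq] at e
    obtain ⟨e1, e2⟩ := e
    have h2 : p.2 = q.2 := mul_left_cancel₀ hD.ne' (add_right_cancel e1)
    rw [h2] at e2
    have h1 : p.1 = q.1 := mul_left_cancel₀ hA.ne' (by linarith)
    exact Prod.ext h1 h2
  rw [← Finset.card_image_of_injOn hinj]
  apply hK (A * C - B ^ 2) ((A * F - B * E) ^ 2 - (A * C - B ^ 2) * (A * G - E ^ 2)) _ _ hD
  · nlinarith [one_le_pow₀ hT (n := 4)]
  · push_cast
    apply aux_conic_bound _ _ _ _ _ _ _ (by linarith) bA bB bE bF bG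
    refine (abs_sub _ _).trans ?_
    rw [abs_mul, abs_pow]
    have h1 : |(A : ℝ)| * |(C : ℝ)| ≤ T * T := by gcongr
    have h2 : |(B : ℝ)| ^ 2 ≤ T ^ 2 := by gcongr
    nlinarith
  · intro p hp
    obtain ⟨q, hq, rfl⟩ := Finset.mem_image.1 hp
    have h := hs q hq
    linear_combination A * (A * C - B ^ 2) * h

theorem aux_core (δ : ℝ) (hδ : 0 < δ) :
    ∃ K : ℝ, 1 ≤ K ∧ ∀ (a b : Fin 4 → ℤ) (t u : ℤ) (m : ℕ) (M : ℝ) (s : Finset (Fin 4 → ℤ)),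
      a 0 * b 1 - a 1 * b 0 ≠ 0 → 1 ≤ M → 1 ≤ m →
      (∀ i, |(a i : ℝ)| ≤ M) → (∀ i, |(b i : ℝ)| ≤ M) → |(t : ℝ)| ≤ M → |(u : ℝ)| ≤ M →
      (∀ x ∈ s, ∑ i, x i ^ 2 = (m : ℤ) ∧ ∑ i, a i * x i = t ∧ ∑ i, b i * x i = u) →
      (s.card : ℝ) ≤ K * (8 * (12 * M ^ 4 * m) ^ 4) ^ δ := by
  classical
  obtain ⟨K, hK1, hK⟩ := aux_conic δ hδ
  refine ⟨K, hK1, ?_⟩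
  intro a b t u m M s hΔ hM hm ba bb bt bu hs
  simp only [Fin.sum_univ_four] at hs
  set Δ := a 0 * b 1 - a 1 * b 0 with hΔdef
  obtain ⟨P0, hP0⟩ : ∃ z, z = t * b 1 - u * a 1 := ⟨_, rfl⟩
  obtain ⟨P1, hP1⟩ : ∃ z, z = b 2 * a 1 - a 2 * b 1 := ⟨_, rfl⟩
  obtain ⟨P2, hP2⟩ : ∃ z, z = b 3 * a 1 - a 3 * b 1 := ⟨_, rfl⟩
  obtain ⟨Q0, hQ0⟩ : ∃ z, z = a 0 * u - b 0 * t := ⟨_, rfl⟩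
  obtain ⟨Q1, hQ1⟩ : ∃ z, z = b 0 * a 2 - a 0 * b 2 := ⟨_, rfl⟩
  obtain ⟨Q2, hQ2⟩ : ∃ z, z = b 0 * a 3 - a 0 * b 3 := ⟨_, rfl⟩
  have e0 : ∀ x ∈ s, Δ * x 0 = P0 + P1 * x 2 + P2 * x 3 := by
    intro x hx
    obtain ⟨-, h1, h2⟩ := hs x hx
    rw [hΔdef, hP0, hP1, hP2]
    linear_combination b 1 * h1 - a 1 * h2
  have e1 : ∀ x ∈ s, Δ * x 1 = Q0 + Q1 * x 2 + Q2 * x 3 := by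
    intro x hx
    obtain ⟨-, h1, h2⟩ := hs x hx
    rw [hΔdef, hQ0, hQ1, hQ2]
    linear_combination a 0 * h2 - b 0 * h1
  have hinj : Set.InjOn (fun x : Fin 4 → ℤ => (x 2, x 3)) s := by
    intro x hx y hy e
    simp only [Prod.mk.injEq] at e
    have h0 : x 0 = y 0 := mul_left_cancel₀ hΔ (by rw [e0 x hx, e0 y hy, e.1, e.2])
    have h1 : x 1 = y 1 := mul_left_cancel₀ hΔ (by rw [e1 x hx, e1 y hy, e.1, e.2])
    funext i
    fin_cases i
    · exact h0
    · exact h1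
    · exact e.1
    · exact e.2
  have hm' : (1 : ℝ) ≤ m := by exact_mod_cast hm
  have bd : ∀ w x y z : ℝ, |w| ≤ M → |x| ≤ M → |y| ≤ M → |z| ≤ M → |w * x - y * z| ≤ 2 * M ^ 2 := by
    intro w x y z hw hx hy hz
    refine (abs_sub _ _).trans ?_
    rw [abs_mul, abs_mul]
    have h1 : |w| * |x| ≤ M * M := by gcongr
    have h2 : |y| * |z| ≤ M * M := by gcongr
    nlinarith
  have bΔ : |(Δ : ℝ)| ≤ 2 * M ^ 2 := by
    rw [hΔdef]; push_cast; exact bd _ _ _ _ (ba _) (bb _) (ba _) (bb _)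
  have bP0 : |(P0 : ℝ)| ≤ 2 * M ^ 2 := by
    rw [hP0]; push_cast; exact bd _ _ _ _ bt (bb _) bu (ba _)
  have bP1 : |(P1 : ℝ)| ≤ 2 * M ^ 2 := by
    rw [hP1]; push_cast; exact bd _ _ _ _ (bb _) (ba _) (ba _) (bb _)
  have bP2 : |(P2 : ℝ)| ≤ 2 * M ^ 2 := by
    rw [hP2]; push_cast; exact bd _ _ _ _ (bb _) (ba _) (ba _) (bb _)
  have bQ0 : |(Q0 : ℝ)| ≤ 2 * M ^ 2 := by
    rw [hQ0]; push_cast; exact bd _ _ _ _ (ba _) bu (bb _) bt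
  have bQ1 : |(Q1 : ℝ)| ≤ 2 * M ^ 2 := by
    rw [hQ1]; push_cast; exact bd _ _ _ _ (bb _) (ba _) (ba _) (bb _)
  have bQ2 : |(Q2 : ℝ)| ≤ 2 * M ^ 2 := by
    rw [hQ2]; push_cast; exact bd _ _ _ _ (bb _) (ba _) (ba _) (bb _)
  have bmul : ∀ {x y : ℝ}, |x| ≤ 2 * M ^ 2 → |y| ≤ 2 * M ^ 2 → |x * y| ≤ 4 * M ^ 4 := by
    intro x y hx hy
    rw [abs_mul]
    have h1 : |x| * |y| ≤ (2 * M ^ 2) * (2 * M ^ 2) := by gcongr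
    nlinarith
  have hM4 : 1 ≤ M ^ 4 := one_le_pow₀ hM
  have hMm : M ^ 4 ≤ M ^ 4 * m := by nlinarith
  have hΔ2 : 0 < Δ ^ 2 := by positivity
  rw [← Finset.card_image_of_injOn hinj]
  apply hK (Δ ^ 2 + P1 ^ 2 + Q1 ^ 2) (P1 * P2 + Q1 * Q2) (Δ ^ 2 + P2 ^ 2 + Q2 ^ 2)
    (P0 * P1 + Q0 * Q1) (P0 * P2 + Q0 * Q2) (P0 ^ 2 + Q0 ^ 2 - Δ ^ 2 * m) (12 * M ^ 4 * m)
  · positivity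
  · have : (Δ ^ 2 + P1 ^ 2 + Q1 ^ 2) * (Δ ^ 2 + P2 ^ 2 + Q2 ^ 2) - (P1 * P2 + Q1 * Q2) ^ 2
      = Δ ^ 2 * Δ ^ 2 + Δ ^ 2 * (P1 ^ 2 + Q1 ^ 2 + P2 ^ 2 + Q2 ^ 2) + (P1 * Q2 - P2 * Q1) ^ 2 := by
      ring
    rw [this]; positivity
  · nlinarith
  · push_cast
    have h1 := abs_le.1 (bmul bΔ bΔ)
    have h2 := abs_le.1 (bmul bP1 bP1)
    have h3 := abs_le.1 (bmul bQ1 bQ1)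
    rw [abs_le]; constructor <;> linarith [h1.1, h1.2, h2.1, h2.2, h3.1, h3.2]
  · push_cast
    have h2 := abs_le.1 (bmul bP1 bP2)
    have h3 := abs_le.1 (bmul bQ1 bQ2)
    rw [abs_le]; constructor <;> linarith [h2.1, h2.2, h3.1, h3.2]
  · push_cast
    have h1 := abs_le.1 (bmul bΔ bΔ)
    have h2 := abs_le.1 (bmul bP2 bP2)
    have h3 := abs_le.1 (bmul bQ2 bQ2)
    rw [abs_le]; constructor <;> linarith [h1.1, h1.2, h2.1, h2.2, h3.1, h3.2]
  · push_cast
    have h2 := abs_le.1 (bmul bP0 bP1)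
    have h3 := abs_le.1 (bmul bQ0 bQ1)
    rw [abs_le]; constructor <;> linarith [h2.1, h2.2, h3.1, h3.2]
  · push_cast
    have h2 := abs_le.1 (bmul bP0 bP2)
    have h3 := abs_le.1 (bmul bQ0 bQ2)
    rw [abs_le]; constructor <;> linarith [h2.1, h2.2, h3.1, h3.2]
  · push_cast
    have h1 : (Δ : ℝ) ^ 2 * m ≤ 4 * M ^ 4 * m := by
      have := (abs_le.1 (bmul bΔ bΔ)).2
      gcongr
      linarith
    have h1' : 0 ≤ (Δ : ℝ) ^ 2 * m := by positivity
    have h2 := abs_le.1 (bmul bP0 bP0)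
    have h3 := abs_le.1 (bmul bQ0 bQ0)
    rw [abs_le]; constructor <;> linarith [h2.1, h2.2, h3.1, h3.2, sq_nonneg (P0 : ℝ), sq_nonneg (Q0 : ℝ)]
  · intro p hp
    obtain ⟨x, hx, rfl⟩ := Finset.mem_image.1 hp
    have h0 := e0 x hx
    have h1 := e1 x hx
    obtain ⟨h2, -, -⟩ := hs x hx
    simp only
    linear_combination Δ ^ 2 * h2 - (Δ * x 0 + (P0 + P1 * x 2 + P2 * x 3)) * h0
      - (Δ * x 1 + (Q0 + Q1 * x 2 + Q2 * x 3)) * h1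

theorem aux_core' (c : ℝ) (hc : 0 < c) (ε : ℝ) (hε : 0 < ε) :
    ∃ K : ℝ, 1 ≤ K ∧ ∀ (a b : Fin 4 → ℤ) (t u : ℤ) (m : ℕ) (s : Finset (Fin 4 → ℤ)),
      (∃ i j, a i * b j - a j * b i ≠ 0) → 1 ≤ m →
      (∀ i, |(a i : ℝ)| ≤ (m : ℝ) ^ c) → (∀ i, |(b i : ℝ)| ≤ (m : ℝ) ^ c) →
      |(t : ℝ)| ≤ (m : ℝ) ^ c → |(u : ℝ)| ≤ (m : ℝ) ^ c →
      (∀ x ∈ s, ∑ i, x i ^ 2 = (m : ℤ) ∧ ∑ i, a i * x i = t ∧ ∑ i, b i * x i = u) →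
      (s.card : ℝ) ≤ K * (m : ℝ) ^ ε := by
  classical
  set δ := ε / (16 * c + 4) with hδdef
  have hδ : 0 < δ := by positivity
  obtain ⟨K, hK1, hK⟩ := aux_core δ hδ
  have h8 : (1 : ℝ) ≤ (8 * 12 ^ 4) ^ δ := Real.one_le_rpow (by norm_num) hδ.le
  refine ⟨K * (8 * 12 ^ 4) ^ δ, by nlinarith, ?_⟩
  intro a b t u m s ⟨i, j, hij⟩ hm ba bb bt bu hs
  have hm' : (1 : ℝ) ≤ m := by exact_mod_cast hm
  have hne : i ≠ j := by rintro rfl; apply hij; ring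
  have hσ : ∀ i j : Fin 4, i ≠ j → ∃ σ : Equiv.Perm (Fin 4), σ 0 = i ∧ σ 1 = j := by decide
  obtain ⟨σ, h0, h1⟩ := hσ i j hne
  have hinj : Set.InjOn (fun x : Fin 4 → ℤ => x ∘ σ) s := by
    intro x _ y _ e
    exact σ.surjective.injective_comp_right e
  have hM : 1 ≤ (m : ℝ) ^ c := Real.one_le_rpow hm' hc.le
  have key := hK (a ∘ σ) (b ∘ σ) t u m ((m : ℝ) ^ c) (s.image (fun x : Fin 4 → ℤ => x ∘ σ))
    (by simpa [h0, h1] using hij) hM hm (fun i => ba _) (fun i => bb _) bt bu ?_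
  · rw [Finset.card_image_of_injOn hinj] at key
    refine key.trans (le_of_eq ?_)
    have e1 : (8 * (12 * ((m : ℝ) ^ c) ^ 4 * m) ^ 4) = (8 * 12 ^ 4) * (m : ℝ) ^ (16 * c + 4) := by
      rw [Real.rpow_add (by linarith), mul_comm 16 c, Real.rpow_mul (by linarith)]
      have : ((m : ℝ) ^ c) ^ (16 : ℝ) = ((m : ℝ) ^ c) ^ 16 := by
        exact_mod_cast Real.rpow_natCast ((m : ℝ) ^ c) 16
      rw [this]
      have : (m : ℝ) ^ (4 : ℝ) = (m : ℝ) ^ 4 := by exact_mod_cast Real.rpow_natCast (m : ℝ) 4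
      rw [this]
      ring
    rw [e1, Real.mul_rpow (by norm_num) (by positivity), ← Real.rpow_mul (by linarith), hδdef,
      mul_div_cancel₀ _ (by positivity), mul_assoc]
  · intro y hy
    obtain ⟨x, hx, rfl⟩ := Finset.mem_image.1 hy
    obtain ⟨g1, g2, g3⟩ := hs x hx
    refine ⟨?_, ?_, ?_⟩
    · rw [← g1]; exact Equiv.sum_comp σ (fun i => x i ^ 2)
    · rw [← g2]; exact Equiv.sum_comp σ (fun i => a i * x i)
    · rw [← g3]; exact Equiv.sum_comp σ (fun i => b i * x i)

theorem statement_10 (c : ℝ) (hc : 0 < c) (ε : ℝ) (hε : 0 < ε) :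
    ∃ C : ℝ, 0 < C ∧
      ∀ m : ℕ,
        (∀ (v : Fin 3 → ℤ) (t : ℤ), v ≠ 0 →
          (∀ i, ((|v i| : ℤ) : ℝ) ≤ (m : ℝ) ^ c) → ((|t| : ℤ) : ℝ) ≤ (m : ℝ) ^ c →
          (({x ∈ latSphere 3 m | ∑ i, v i * x i = t}).ncard : ℝ) ≤ C * (m : ℝ) ^ ε) ∧
        (∀ (v₁ v₂ : Fin 4 → ℤ) (t₁ t₂ : ℤ), v₁ ≠ 0 → v₂ ≠ 0 →
          (∀ i, ((|v₁ i| : ℤ) : ℝ) ≤ (m : ℝ) ^ c) → ((|t₁| : ℤ) : ℝ) ≤ (m : ℝ) ^ c →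
          (∀ i, ((|v₂ i| : ℤ) : ℝ) ≤ (m : ℝ) ^ c) → ((|t₂| : ℤ) : ℝ) ≤ (m : ℝ) ^ c →
          intHyperplane 4 v₁ t₁ ≠ intHyperplane 4 v₂ t₂ →
          (({x ∈ latSphere 4 m | (∑ i, v₁ i * x i = t₁) ∧ (∑ i, v₂ i * x i = t₂)}).ncard : ℝ) ≤
            C * (m : ℝ) ^ ε) := by
  classical
  obtain ⟨K, hK1, hK⟩ := aux_core' c hc ε hε
  refine ⟨K, by linarith, ?_⟩
  intro m
  have hmpos : ∀ {d : ℕ} (v : Fin d → ℤ), v ≠ 0 →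
      (∀ i, ((|v i| : ℤ) : ℝ) ≤ (m : ℝ) ^ c) → 1 ≤ m := by
    intro d v hv hb
    rcases Nat.eq_zero_or_pos m with h | h
    · exfalso
      apply hv
      funext i
      have := hb i
      rw [h, Nat.cast_zero, Real.zero_rpow hc.ne'] at this
      have h2 : |v i| ≤ 0 := by exact_mod_cast this
      exact abs_nonpos_iff.1 h2
    · exact h
  constructor
  · intro v t hv bv bt
    have hm := hmpos v hv bv
    have hm' : (1 : ℝ) ≤ m := by exact_mod_cast hm
    have hM : 1 ≤ (m : ℝ) ^ c := Real.one_le_rpow hm' hc.le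
    set S := {x ∈ latSphere 3 m | ∑ i, v i * x i = t} with hS
    by_cases hfin : S.Finite
    swap
    · rw [Set.Infinite.ncard hfin]
      simp only [Nat.cast_zero]
      positivity
    rw [Set.ncard_eq_toFinset_card S hfin]
    obtain ⟨i, hi⟩ := Function.ne_iff.1 hv
    have hinj : Function.Injective (fun x : Fin 3 → ℤ => (Fin.snoc x 0 : Fin 4 → ℤ)) := by
      intro x y e
      exact (Fin.snoc_injective2 (α := fun _ : Fin 4 => ℤ) e).1
    rw [← Finset.card_image_of_injective _ hinj]
    apply hK (Fin.snoc v 0) (Fin.snoc 0 1) t 0 m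
    · refine ⟨i.castSucc, Fin.last 3, ?_⟩
      rw [Fin.snoc_castSucc (α := fun _ => ℤ), Fin.snoc_last, Fin.snoc_last]
      simpa using hi
    · exact hm
    · intro j
      refine Fin.lastCases ?_ (fun k => ?_) j
      · simp only [Fin.snoc_last, Int.cast_zero, abs_zero]; positivity
      · rw [Fin.snoc_castSucc (α := fun _ => ℤ)]; simpa using bv k
    · intro j
      refine Fin.lastCases ?_ (fun k => ?_) j
      · rw [Fin.snoc_last]; simpa using hM
      · rw [Fin.snoc_castSucc (α := fun _ => ℤ)]; simp only [Pi.zero_apply, Int.cast_zero, abs_zero]; positivity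
    · simpa using bt
    · simp only [Int.cast_zero, abs_zero]; positivity
    · intro y hy
      obtain ⟨x, hx, rfl⟩ := Finset.mem_image.1 hy
      have hx := hfin.mem_toFinset.1 hx
      obtain ⟨h1, h2⟩ := hx
      have h1 : ∑ i, x i ^ 2 = (m : ℤ) := h1
      refine ⟨?_, ?_, ?_⟩
      · rw [Fin.sum_univ_castSucc]; simp only [Fin.snoc_castSucc (α := fun _ => ℤ), Fin.snoc_last]
        simpa using h1
      · rw [Fin.sum_univ_castSucc]; simp only [Fin.snoc_castSucc (α := fun _ => ℤ), Fin.snoc_last]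
        simpa using h2
      · rw [Fin.sum_univ_castSucc]; simp only [Fin.snoc_castSucc (α := fun _ => ℤ), Fin.snoc_last]
        simp
  · intro v₁ v₂ t₁ t₂ hv₁ hv₂ bv₁ bt₁ bv₂ bt₂ hne
    have hm := hmpos v₁ hv₁ bv₁
    set S := {x ∈ latSphere 4 m | (∑ i, v₁ i * x i = t₁) ∧ (∑ i, v₂ i * x i = t₂)} with hS
    by_cases hfin : S.Finite
    swap
    · rw [Set.Infinite.ncard hfin]
      simp only [Nat.cast_zero]
      positivity
    by_cases hmin : ∃ i j, v₁ i * v₂ j - v₁ j * v₂ i ≠ 0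
    · rw [Set.ncard_eq_toFinset_card S hfin]
      apply hK v₁ v₂ t₁ t₂ m _ hmin hm (fun i => by simpa using bv₁ i) (fun i => by simpa using bv₂ i)
        (by simpa using bt₁) (by simpa using bt₂)
      intro x hx
      have hx := hfin.mem_toFinset.1 hx
      exact ⟨hx.1, hx.2.1, hx.2.2⟩
    · push Not at hmin
      have hemp : S = ∅ := by
        rw [Set.eq_empty_iff_forall_notMem]
        rintro x ⟨-, h1, h2⟩
        apply hne
        obtain ⟨i, hi⟩ := Function.ne_iff.1 hv₁
        have hi1 : v₁ i ≠ 0 := hi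
        have hi2 : v₂ i ≠ 0 := by
          intro h0
          apply hv₂
          funext j
          have := hmin i j
          rw [h0, mul_zero, sub_zero] at this
          exact (mul_eq_zero.1 this).resolve_left hi1
        have ht : v₁ i * t₂ = v₂ i * t₁ := by
          rw [← h1, ← h2, Finset.mul_sum, Finset.mul_sum]
          apply Finset.sum_congr rfl
          intro j _
          linear_combination x j * hmin i j
        have hi1R : (v₁ i : ℝ) ≠ 0 := by exact_mod_cast hi1
        have hi2R : (v₂ i : ℝ) ≠ 0 := by exact_mod_cast hi2
        have htR : (v₁ i : ℝ) * t₂ = v₂ i * t₁ := by exact_mod_cast ht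
        ext y
        have hs : (v₁ i : ℝ) * ∑ j, (v₂ j : ℝ) * y j = v₂ i * ∑ j, (v₁ j : ℝ) * y j := by
          rw [Finset.mul_sum, Finset.mul_sum]
          apply Finset.sum_congr rfl
          intro j _
          have : (v₁ i : ℝ) * v₂ j - v₁ j * v₂ i = 0 := by exact_mod_cast hmin i j
          linear_combination y j * this
        simp only [intHyperplane, Set.mem_ofPred_eq]
        constructor
        · intro h
          apply mul_left_cancel₀ hi1R
          rw [hs, h, htR]
        · intro h
          apply mul_left_cancel₀ hi2R
          rw [← hs, h, htR]
      rw [hemp]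
      simp only [Set.ncard_empty, Nat.cast_zero]
      positivity
end
end

section
/- Let d be a natural number, let P be a finite non-empty set of points in ℝ^d, and let L be a finite non-empty collection of subsets of ℝ^d. Suppose there exist real numbers 𝒞 > 0 and a, b ∈ (1/2, 1) such that I(P', L') ≤ 𝒞·(|P'|^a |L'|^b + |P'| + |L'|) holds for every non-empty P' ⊆ P and every non-empty L' ⊆ L. Then there is a constant K(a, b) > 0, depending only on a and b, such that for all weight functions w : P → ℕ and w' : L → ℕ (with positive values), I_{w,w'}(P, L) ≤ K(a,b) · 𝒞 · ( ‖w‖_2^{2−2a} ‖w‖_1^{2a−1} ‖w'‖_2^{2−2b} ‖w'‖_1^{2b−1} + ‖w‖_∞ ‖w'‖_1 + ‖w‖_1 ‖w'‖_∞ ). -/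
open Finset

noncomputable section

/-- dyadic level set -/
def lev {ι : Type*} (P : Finset ι) (w : ι → ℕ) (i : ℕ) : Finset ι :=
  P.filter (fun p => Nat.log 2 (w p) = i)

lemma geom_bound (r : ℝ) (h0 : 0 ≤ r) (h1 : r < 1) (N : ℕ) :
    ∑ i ∈ range N, r ^ i ≤ (1 - r)⁻¹ := by
  have h := Summable.sum_le_tsum (range N) (fun i _ => pow_nonneg h0 i)
    (summable_geometric_of_lt_one h0 h1)
  rwa [tsum_geometric_of_lt_one h0 h1] at h

lemma two_sided (α β t : ℝ) (hα : 0 < α) (hβ : 0 < β) (ht : 1 ≤ t) (f : ℕ → ℝ) (D : ℝ)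
    (hD : 0 ≤ D)
    (h1 : ∀ i, f i ≤ D * ((2 : ℝ) ^ i / t) ^ α)
    (h2 : ∀ i, f i ≤ D * ((2 : ℝ) ^ i / t) ^ (-β)) (N : ℕ) :
    ∑ i ∈ range N, f i ≤
      D * ((1 - (2 : ℝ) ^ (-α))⁻¹ + (1 - (2 : ℝ) ^ (-β))⁻¹) := by
  have ht0 : 0 < t := by linarith
  obtain ⟨n, hn1, hn2⟩ := exists_nat_pow_near ht (one_lt_two)
  have hrpow : ∀ (γ : ℝ) (k : ℕ), ((2 : ℝ) ^ k) ^ (-γ) = ((2 : ℝ) ^ (-γ)) ^ k := by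
    intro γ k
    rw [← Real.rpow_natCast, ← Real.rpow_natCast, ← Real.rpow_mul (by norm_num),
      ← Real.rpow_mul (by norm_num), mul_comm]
  have hlt : ∀ γ : ℝ, 0 < γ → (2 : ℝ) ^ (-γ) < 1 := fun γ hγ =>
    Real.rpow_lt_one_of_one_lt_of_neg one_lt_two (by linarith)
  have hnn : ∀ γ : ℝ, 0 ≤ (2 : ℝ) ^ (-γ) := fun γ => by positivity
  have hlow : ∀ i, i ≤ n → f i ≤ D * ((2 : ℝ) ^ (-α)) ^ (n - i) := by
    intro i hi
    refine (h1 i).trans (mul_le_mul_of_nonneg_left ?_ hD)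
    rw [← hrpow, Real.rpow_neg (by positivity), ← Real.inv_rpow (by positivity)]
    apply Real.rpow_le_rpow (by positivity) _ hα.le
    rw [div_le_iff₀ ht0, ← div_eq_inv_mul, le_div_iff₀ (by positivity), ← pow_add]
    rwa [Nat.add_sub_cancel' hi]
  have hhigh : ∀ k, f (n + 1 + k) ≤ D * ((2 : ℝ) ^ (-β)) ^ k := by
    intro k
    refine (h2 _).trans (mul_le_mul_of_nonneg_left ?_ hD)
    rw [← hrpow]
    apply Real.rpow_le_rpow_of_nonpos (by positivity) _ (by linarith)
    rw [le_div_iff₀ ht0, pow_add, mul_comm]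
    exact mul_le_mul_of_nonneg_right hn2.le (by positivity)
  set g : ℕ → ℝ := fun i => if i ≤ n then D * ((2 : ℝ) ^ (-α)) ^ (n - i)
    else D * ((2 : ℝ) ^ (-β)) ^ (i - (n + 1)) with hg
  have hfg : ∀ i, f i ≤ g i := by
    intro i
    simp only [hg]
    split_ifs with h
    · exact hlow i h
    · have := hhigh (i - (n + 1))
      rwa [Nat.add_sub_cancel' (by omega)] at this
  have hg0 : ∀ i, 0 ≤ g i := by
    intro i
    simp only [hg]
    split_ifs <;> positivity
  calc ∑ i ∈ range N, f i ≤ ∑ i ∈ range N, g i := sum_le_sum fun i _ => hfg i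
    _ ≤ ∑ i ∈ range (n + 1 + N), g i :=
        sum_le_sum_of_subset_of_nonneg (range_subset_range.2 (by omega)) fun i _ _ => hg0 i
    _ = ∑ i ∈ range (n + 1), g i + ∑ k ∈ range N, g (n + 1 + k) := sum_range_add _ _ _
    _ = D * ∑ i ∈ range (n + 1), ((2 : ℝ) ^ (-α)) ^ i
          + D * ∑ k ∈ range N, ((2 : ℝ) ^ (-β)) ^ k := by
        congr 1
        · rw [← sum_range_reflect, mul_sum]
          apply sum_congr rfl
          intro i hi
          have : i ≤ n := by simp at hi; omega
          have h3 : n + 1 - 1 - i ≤ n := by omega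
          have h4 : n - (n + 1 - 1 - i) = i := by omega
          simp only [hg, h3, h4, if_true]
        · rw [mul_sum]
          apply sum_congr rfl
          intro i hi
          have h3 : ¬ (n + 1 + i ≤ n) := by omega
          simp only [hg, h3, if_false, Nat.add_sub_cancel_left]
    _ ≤ _ := by
        rw [mul_add]
        gcongr
        · exact geom_bound _ (hnn _) (hlt _ hα) _
        · exact geom_bound _ (hnn _) (hlt _ hβ) _

lemma lev_le {ι : Type*} {P : Finset ι} {w : ι → ℕ} {i : ℕ} (hw : ∀ p ∈ P, 0 < w p)
    {p : ι} (hp : p ∈ lev P w i) : (2 : ℝ) ^ i ≤ w p := by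
  simp only [lev, mem_filter] at hp
  have := Nat.pow_log_le_self 2 (hw p hp.1).ne'
  rw [hp.2] at this
  exact_mod_cast this

lemma lev_lt {ι : Type*} {P : Finset ι} {w : ι → ℕ} {i : ℕ}
    {p : ι} (hp : p ∈ lev P w i) : w p ≤ 2 * 2 ^ i := by
  simp only [lev, mem_filter] at hp
  have := Nat.lt_pow_succ_log_self (b := 2) (by norm_num) (w p)
  rw [hp.2, pow_succ] at this
  omega

lemma level_sum {ι : Type*} (a : ℝ) (ha1 : 1 / 2 < a) (ha2 : a < 1) (P : Finset ι)
    (hP : P.Nonempty) (w : ι → ℕ) (hw : ∀ p ∈ P, 0 < w p) (N : ℕ) :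
    ∑ i ∈ range N, (2 : ℝ) ^ i * ((lev P w i).card : ℝ) ^ a ≤
      ((1 - (2 : ℝ) ^ (-(1 - a)))⁻¹ + (1 - (2 : ℝ) ^ (-(2 * a - 1)))⁻¹) *
      (Real.sqrt (∑ p ∈ P, (w p : ℝ) ^ 2) ^ (2 - 2 * a) *
                    (∑ p ∈ P, (w p : ℝ)) ^ (2 * a - 1)) := by
  set A := ∑ p ∈ P, (w p : ℝ) with hA
  set B := ∑ p ∈ P, (w p : ℝ) ^ 2 with hB
  have hA0 : 0 < A := sum_pos (fun p hp => by exact_mod_cast hw p hp) hP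
  have hAB : A ≤ B := sum_le_sum fun p hp => by
    have : (1 : ℝ) ≤ w p := by exact_mod_cast hw p hp
    nlinarith
  have hB0 : 0 < B := hA0.trans_le hAB
  have e1 : Real.sqrt B ^ (2 - 2 * a) = B ^ (1 - a) := by
    rw [Real.sqrt_eq_rpow, ← Real.rpow_mul hB0.le]
    congr 1
    ring
  rw [e1, mul_comm]
  have c1 : ∀ i, (2 : ℝ) ^ i * (lev P w i).card ≤ A := by
    intro i
    calc (2 : ℝ) ^ i * (lev P w i).card = ∑ p ∈ lev P w i, (2 : ℝ) ^ i := by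
          rw [sum_const, nsmul_eq_mul, mul_comm]
      _ ≤ ∑ p ∈ lev P w i, (w p : ℝ) := sum_le_sum fun p hp => lev_le hw hp
      _ ≤ A := sum_le_sum_of_subset_of_nonneg (filter_subset _ _) fun _ _ _ => by positivity
  have c2 : ∀ i, ((2 : ℝ) ^ i) ^ 2 * (lev P w i).card ≤ B := by
    intro i
    calc ((2 : ℝ) ^ i) ^ 2 * (lev P w i).card = ∑ p ∈ lev P w i, ((2 : ℝ) ^ i) ^ 2 := by
          rw [sum_const, nsmul_eq_mul, mul_comm]
      _ ≤ ∑ p ∈ lev P w i, (w p : ℝ) ^ 2 := sum_le_sum fun p hp => by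
          have := lev_le hw hp
          gcongr
      _ ≤ B := sum_le_sum_of_subset_of_nonneg (filter_subset _ _) fun _ _ _ => by positivity
  apply two_sided (1 - a) (2 * a - 1) (B / A) (by linarith) (by linarith)
    ((one_le_div hA0).2 hAB) _ _ (by positivity)
  · intro i
    have hx : (0 : ℝ) < 2 ^ i := by positivity
    have h : ((lev P w i).card : ℝ) ≤ A / 2 ^ i := by
      rw [le_div_iff₀ hx, mul_comm]; exact c1 i
    generalize (2 : ℝ) ^ i = x at *
    calc x * ((lev P w i).card : ℝ) ^ a ≤ x * (A / x) ^ a := by gcongr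
      _ = _ := by
        rw [Real.div_rpow hx.le (by positivity), Real.div_rpow hB0.le hA0.le,
          Real.div_rpow hA0.le hx.le]
        have e2 : A ^ (2 * a - 1) * A ^ (1 - a) = A ^ a := by
          rw [← Real.rpow_add hA0]; congr 1; ring
        have e3 : x ^ (1 - a) * x ^ a = x := by
          rw [← Real.rpow_add hx]; simp
        have p1 : 0 < B ^ (1 - a) := by positivity
        have p2 : 0 < x ^ a := by positivity
        field_simp
        rw [mul_comm a 2]
        linear_combination (-x) * e2 - (A ^ (2 * a - 1) * A ^ (1 - a)) * e3
  · intro i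
    have hx : (0 : ℝ) < 2 ^ i := by positivity
    have h : ((lev P w i).card : ℝ) ≤ B / (2 ^ i) ^ 2 := by
      rw [le_div_iff₀ (by positivity), mul_comm]; exact c2 i
    generalize (2 : ℝ) ^ i = x at *
    calc x * ((lev P w i).card : ℝ) ^ a ≤ x * (B / x ^ 2) ^ a := by gcongr
      _ = _ := by
        rw [Real.rpow_neg (by positivity), Real.div_rpow hx.le (by positivity),
          Real.div_rpow hB0.le hA0.le, Real.div_rpow hB0.le (by positivity)]
        have e2 : B ^ (1 - a) * B ^ (2 * a - 1) = B ^ a := by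
          rw [← Real.rpow_add hB0]; congr 1; ring
        have e3 : x * x ^ (2 * a - 1) = (x ^ 2) ^ a := by
          rw [← Real.rpow_natCast, ← Real.rpow_mul hx.le]
          nth_rewrite 1 [← Real.rpow_one x]
          rw [← Real.rpow_add hx]; congr 1; push_cast; ring
        have p1 : 0 < A ^ (2 * a - 1) := by positivity
        have p2 : 0 < x ^ (2 * a - 1) := by positivity
        rw [← e3, ← e2]
        field_simp

lemma sum_lev {ι M : Type*} [AddCommMonoid M] (P : Finset ι) (w : ι → ℕ) (f : ι → M) :
    ∑ p ∈ P, f p = ∑ i ∈ range (Nat.log 2 (P.sup w) + 1), ∑ p ∈ lev P w i, f p := by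
  unfold lev
  rw [sum_fiberwise_of_maps_to]
  intro p hp
  rw [mem_range, Nat.lt_succ_iff]
  exact Nat.log_mono_right (le_sup (f := w) hp)

lemma sum_two {ι : Type*} (P : Finset ι) (hP : P.Nonempty) (w : ι → ℕ)
    (hw : ∀ p ∈ P, 0 < w p) :
    ∑ i ∈ range (Nat.log 2 (P.sup w) + 1), (2 : ℝ) ^ i ≤ 2 * ((P.sup w : ℕ) : ℝ) := by
  obtain ⟨p, hp⟩ := hP
  have h0 : P.sup w ≠ 0 := ((hw p hp).trans_le (le_sup (f := w) hp)).ne'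
  have h1 : (2 : ℝ) ^ (Nat.log 2 (P.sup w)) ≤ ((P.sup w : ℕ) : ℝ) := by
    exact_mod_cast Nat.pow_log_le_self 2 h0
  rw [geom_sum_eq (by norm_num), pow_succ]
  linarith

lemma sum_card {ι : Type*} (P : Finset ι) (w : ι → ℕ)
    (hw : ∀ p ∈ P, 0 < w p) :
    ∑ i ∈ range (Nat.log 2 (P.sup w) + 1), (2 : ℝ) ^ i * (lev P w i).card
      ≤ ∑ p ∈ P, (w p : ℝ) := by
  rw [sum_lev P w]
  apply sum_le_sum
  intro i _
  rw [mul_comm, ← nsmul_eq_mul, ← sum_const]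
  exact sum_le_sum fun p hp => lev_le hw hp

lemma final_alg (C Ka Kb S F G Pc Lc T T' X Y A B U V : ℝ) (hC : 0 < C) (hKa0 : 0 < Ka)
    (hKb0 : 0 < Kb) (hS : S ≤ 4 * C * (F * G + Pc * T' + T * Lc))
    (s1 : F ≤ Ka * X) (s2 : G ≤ Kb * Y) (s3 : Pc ≤ A) (s4 : Lc ≤ B) (s5 : T ≤ 2 * U)
    (s6 : T' ≤ 2 * V) (hX : 0 ≤ X) (hY : 0 ≤ Y) (hA : 0 ≤ A) (hB : 0 ≤ B) (hU : 0 ≤ U)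
    (hV : 0 ≤ V) (hG : 0 ≤ G) (hT : 0 ≤ T') (hL : 0 ≤ Lc) :
    S ≤ (4 * (Ka * Kb) + 8) * C * (X * Y + U * B + A * V) := by
  have m1 := mul_le_mul s1 s2 hG (by positivity)
  have m2 := mul_le_mul s3 s6 hT hA
  have m3 := mul_le_mul s5 s4 hL (by positivity)
  refine hS.trans ((mul_le_mul_of_nonneg_left (add_le_add (add_le_add m1 m2) m3)
    (by positivity)).trans ?_)
  have q : 0 ≤ C * (8 * (X * Y) + 4 * (Ka * Kb) * (U * B) + 4 * (Ka * Kb) * (A * V)) := by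
    positivity
  linarith

set_option maxHeartbeats 1000000 in
theorem statement_11 (a b : ℝ) (ha1 : 1 / 2 < a) (ha2 : a < 1) (hb1 : 1 / 2 < b) (hb2 : b < 1) :
    ∃ K : ℝ, 0 < K ∧
      ∀ (d : ℕ) (P : Finset (Fin d → ℝ)) (L : Finset (Set (Fin d → ℝ))),
        P.Nonempty → L.Nonempty →
        ∀ 𝒞 : ℝ, 0 < 𝒞 →
          (∀ P' ⊆ P, ∀ L' ⊆ L, P'.Nonempty → L'.Nonempty →
            ((∑ p ∈ P', ∑ l ∈ L', l.indicator (fun _ => (1 : ℕ)) p : ℕ) : ℝ) ≤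
              𝒞 * ((P'.card : ℝ) ^ a * (L'.card : ℝ) ^ b + P'.card + L'.card)) →
          ∀ (w : (Fin d → ℝ) → ℕ) (w' : Set (Fin d → ℝ) → ℕ),
            (∀ p ∈ P, 0 < w p) → (∀ l ∈ L, 0 < w' l) →
            ((∑ p ∈ P, ∑ l ∈ L, l.indicator (fun _ => w p * w' l) p : ℕ) : ℝ) ≤
              K * 𝒞 *
                (Real.sqrt (∑ p ∈ P, (w p : ℝ) ^ 2) ^ (2 - 2 * a) *
                    (∑ p ∈ P, (w p : ℝ)) ^ (2 * a - 1) *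
                    Real.sqrt (∑ l ∈ L, (w' l : ℝ) ^ 2) ^ (2 - 2 * b) *
                    (∑ l ∈ L, (w' l : ℝ)) ^ (2 * b - 1) +
                  ((P.sup w : ℕ) : ℝ) * (∑ l ∈ L, (w' l : ℝ)) +
                  (∑ p ∈ P, (w p : ℝ)) * ((L.sup w' : ℕ) : ℝ)) := by
  have hpos : ∀ γ : ℝ, 0 < γ → 0 < (1 - (2 : ℝ) ^ (-γ))⁻¹ := fun γ hγ =>
    inv_pos.2 (sub_pos.2 (Real.rpow_lt_one_of_one_lt_of_neg one_lt_two (by linarith)))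
  obtain ⟨Ka, hKa⟩ : ∃ x, x = ((1 - (2 : ℝ) ^ (-(1 - a)))⁻¹ + (1 - (2 : ℝ) ^ (-(2 * a - 1)))⁻¹) :=
    ⟨_, rfl⟩
  obtain ⟨Kb, hKb⟩ : ∃ x, x = ((1 - (2 : ℝ) ^ (-(1 - b)))⁻¹ + (1 - (2 : ℝ) ^ (-(2 * b - 1)))⁻¹) :=
    ⟨_, rfl⟩
  have hKa0 : 0 < Ka := hKa ▸ add_pos (hpos _ (by linarith)) (hpos _ (by linarith))
  have hKb0 : 0 < Kb := hKb ▸ add_pos (hpos _ (by linarith)) (hpos _ (by linarith))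
  refine ⟨4 * (Ka * Kb) + 8, by positivity, ?_⟩
  intro d P L hP hL C hC H w w' hw hw'
  set N := Nat.log 2 (P.sup w) + 1 with hN
  set M := Nat.log 2 (L.sup w') + 1 with hM
  have HI : ∀ i j, ((∑ p ∈ lev P w i, ∑ l ∈ lev L w' j,
      l.indicator (fun _ => w p * w' l) p : ℕ) : ℝ) ≤
      4 * C * (2 ^ i * ((lev P w i).card : ℝ) ^ a * (2 ^ j * ((lev L w' j).card : ℝ) ^ b)
        + 2 ^ i * (lev P w i).card * 2 ^ j + 2 ^ i * (2 ^ j * (lev L w' j).card)) := by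
    intro i j
    by_cases h1 : (lev P w i).Nonempty
    swap
    · rw [not_nonempty_iff_eq_empty] at h1
      rw [h1]; simp only [sum_empty, Nat.cast_zero]; positivity
    by_cases h2 : (lev L w' j).Nonempty
    swap
    · rw [not_nonempty_iff_eq_empty] at h2
      rw [h2]; simp only [sum_empty, sum_const_zero, Nat.cast_zero]; positivity
    have h := H _ (filter_subset _ _) _ (filter_subset _ _) h1 h2
    have h3 : (∑ p ∈ lev P w i, ∑ l ∈ lev L w' j,
      l.indicator (fun _ => w p * w' l) p : ℕ) ≤ (4 * 2 ^ i * 2 ^ j) *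
        (∑ p ∈ lev P w i, ∑ l ∈ lev L w' j, l.indicator (fun _ => (1 : ℕ)) p : ℕ) := by
      rw [mul_sum]
      refine sum_le_sum fun p hp => ?_
      rw [mul_sum]
      refine sum_le_sum fun l hl => ?_
      by_cases hpl : p ∈ l
      · rw [Set.indicator_of_mem hpl, Set.indicator_of_mem hpl]
        have := Nat.mul_le_mul (lev_lt hp) (lev_lt hl)
        calc _ ≤ _ := this
          _ = _ := by ring
      · rw [Set.indicator_of_notMem hpl]; exact Nat.zero_le _
    have h4 : ((∑ p ∈ lev P w i, ∑ l ∈ lev L w' j,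
      l.indicator (fun _ => w p * w' l) p : ℕ) : ℝ) ≤ (4 * 2 ^ i * 2 ^ j) *
        ((∑ p ∈ lev P w i, ∑ l ∈ lev L w' j, l.indicator (fun _ => (1 : ℕ)) p : ℕ) : ℝ) := by
      exact_mod_cast h3
    refine h4.trans ((mul_le_mul_of_nonneg_left h (by positivity)).trans (le_of_eq ?_))
    simp only [lev]
    ring
  have e : (∑ p ∈ P, ∑ l ∈ L, l.indicator (fun _ => w p * w' l) p) =
      ∑ i ∈ range N, ∑ j ∈ range M, ∑ p ∈ lev P w i, ∑ l ∈ lev L w' j,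
        l.indicator (fun _ => w p * w' l) p := by
    rw [sum_lev P w]
    refine sum_congr rfl fun i _ => ?_
    rw [sum_comm (s := range M)]
    refine sum_congr rfl fun p _ => ?_
    rw [sum_lev L w']
  have hS : ((∑ p ∈ P, ∑ l ∈ L, l.indicator (fun _ => w p * w' l) p : ℕ) : ℝ) ≤
      4 * C * ((∑ i ∈ range N, 2 ^ i * ((lev P w i).card : ℝ) ^ a) *
          (∑ j ∈ range M, 2 ^ j * ((lev L w' j).card : ℝ) ^ b)
        + (∑ i ∈ range N, (2 : ℝ) ^ i * (lev P w i).card) * (∑ j ∈ range M, (2 : ℝ) ^ j)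
        + (∑ i ∈ range N, (2 : ℝ) ^ i) * (∑ j ∈ range M, (2 : ℝ) ^ j * (lev L w' j).card)) := by
    rw [e, Nat.cast_sum]
    simp only [sum_mul_sum, ← sum_add_distrib]
    rw [mul_sum]
    refine sum_le_sum fun i _ => ?_
    rw [Nat.cast_sum, mul_sum]
    exact sum_le_sum fun j _ => HI i j
  have s1 := level_sum a ha1 ha2 P hP w hw N
  have s2 := level_sum b hb1 hb2 L hL w' hw' M
  have s3 := sum_card P w hw
  have s4 := sum_card L w' hw'
  have s5 := sum_two P hP w hw
  have s6 := sum_two L hL w' hw'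
  rw [← hKa] at s1
  rw [← hKb] at s2
  rw [← hN] at s3 s5
  rw [← hM] at s4 s6
  have hX : 0 ≤ Real.sqrt (∑ p ∈ P, (w p : ℝ) ^ 2) ^ (2 - 2 * a) *
                    (∑ p ∈ P, (w p : ℝ)) ^ (2 * a - 1) := by positivity
  have hY : 0 ≤ Real.sqrt (∑ l ∈ L, (w' l : ℝ) ^ 2) ^ (2 - 2 * b) *
                    (∑ l ∈ L, (w' l : ℝ)) ^ (2 * b - 1) := by positivity
  rw [mul_assoc (Real.sqrt (∑ p ∈ P, (w p : ℝ) ^ 2) ^ (2 - 2 * a) *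
                    (∑ p ∈ P, (w p : ℝ)) ^ (2 * a - 1))]
  have hA : 0 ≤ ∑ p ∈ P, (w p : ℝ) := by positivity
  have hB : 0 ≤ ∑ l ∈ L, (w' l : ℝ) := by positivity
  have hU : (0 : ℝ) ≤ ((P.sup w : ℕ) : ℝ) := by positivity
  have hV : (0 : ℝ) ≤ ((L.sup w' : ℕ) : ℝ) := by positivity
  have hT : ∀ i ∈ range M, (0 : ℝ) ≤ 2 ^ i * ((lev L w' i).card : ℝ) ^ b :=
    fun i _ => by positivity
  exact final_alg C Ka Kb _ _ _ _ _ _ _ _ _ _ _ _ _ hC hKa0 hKb0 hS s1 s2 s3 s4 s5 s6 hX hY hA hB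
    hU hV (sum_nonneg hT) (sum_nonneg fun i _ => by positivity)
    (sum_nonneg fun i _ => by positivity)
end
end

section
/- Let m be a natural number and let A be a finite non-empty subset of S_{3,m}. For every ε > 0 there is a constant C(ε) > 0 (and constants C(s, ε) for each s), independent of m and A, such that: (i) r_2(A, n) ≤ C(ε)·m^ε for every n ≠ 0; (ii) r_2(A, 0) ≤ |A|; (iii) r_3(A, 0) ≤ C(ε)·m^ε·|A|; (iv) for every s ≥ 3, r_s(A) ≤ C(s, ε)·m^ε·|A|^{s−2}; and (v) for every s ≥ 2, E_{s,2}(A) ≤ C(s, ε)·m^ε·|A|^{2s−2}. -/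
open Finset

noncomputable section

/-- The additive energy `E_{s,2}(A)`: the number of `2s`-tuples
`(x₁, …, x_{2s}) ∈ A^{2s}` with `x₁ + ⋯ + x_s = x_{s+1} + ⋯ + x_{2s}`. -/
def addEnergy {V : Type*} [AddCommMonoid V] (s : ℕ) (A : Set V) : ℕ :=
  Nat.card {p : (Fin s → V) × (Fin s → V) //
    (∀ i, p.1 i ∈ A) ∧ (∀ i, p.2 i ∈ A) ∧ ∑ i, p.1 i = ∑ i, p.2 i}

/-- The representation function `r_s(A, n)`: the number of `s`-tuples
`(x₁, …, x_s) ∈ A^s` with `x₁ + ⋯ + x_s = n`. -/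
def repCount {V : Type*} [AddCommMonoid V] (s : ℕ) (A : Set V) (n : V) : ℕ :=
  Nat.card {x : Fin s → V // (∀ i, x i ∈ A) ∧ ∑ i, x i = n}

theorem divisor_bound (ε : ℝ) (hε : 0 < ε) : ∃ C : ℝ, 1 ≤ C ∧ ∀ n : ℕ, 0 < n →
    (n.divisors.card : ℝ) ≤ C * (n : ℝ) ^ ε := by
  obtain ⟨P, hP⟩ := exists_nat_ge ((2 : ℝ) ^ (1 / ε))
  have hL : 0 < Real.log 2 := Real.log_pos (by norm_num)
  set K : ℝ := 1 + 1 / (ε * Real.log 2) with hK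
  have hK1 : 1 ≤ K := by
    have : 0 < 1 / (ε * Real.log 2) := by positivity
    linarith
  have hK2 : 1 ≤ K * (ε * Real.log 2) := by
    have : 0 < ε * Real.log 2 := by positivity
    rw [hK, add_mul, one_div_mul_cancel this.ne']
    linarith
  refine ⟨K ^ P, one_le_pow₀ hK1, ?_⟩
  intro n hn
  have key : ∀ p ∈ n.primeFactors, ((n.factorization p + 1 : ℕ) : ℝ) ≤
      (if p < P then K else 1) * ((p : ℝ) ^ n.factorization p) ^ ε := by
    intro p hp
    have hpp := Nat.prime_of_mem_primeFactors hp
    have hp2 : (2 : ℝ) ≤ p := by exact_mod_cast hpp.two_le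
    set a := n.factorization p
    have hcomm : ((p : ℝ) ^ a) ^ ε = ((p : ℝ) ^ ε) ^ a := by
      rw [← Real.rpow_natCast, ← Real.rpow_natCast, ← Real.rpow_mul (by linarith),
        ← Real.rpow_mul (by linarith), mul_comm]
    rw [hcomm]
    push_cast
    split_ifs with h
    · have h1 : 1 + (a : ℝ) * (ε * Real.log 2) ≤ ((p : ℝ) ^ ε) ^ a := by
        have h2 : 1 + ε * Real.log 2 ≤ (2 : ℝ) ^ ε := by
          rw [Real.rpow_def_of_pos (by norm_num)]
          have := Real.add_one_le_exp (Real.log 2 * ε)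
          linarith
        have h3 : (2 : ℝ) ^ ε ≤ (p : ℝ) ^ ε := Real.rpow_le_rpow (by norm_num) hp2 hε.le
        have h0 : 0 < ε * Real.log 2 := by positivity
        calc 1 + (a : ℝ) * (ε * Real.log 2) ≤ (1 + ε * Real.log 2) ^ a :=
              one_add_mul_le_pow (by linarith) a
          _ ≤ _ := pow_le_pow_left₀ (by linarith) (h2.trans h3) a
      have ha : (0 : ℝ) ≤ a := Nat.cast_nonneg a
      calc (a : ℝ) + 1 ≤ K * (1 + (a : ℝ) * (ε * Real.log 2)) := by nlinarith
        _ ≤ _ := mul_le_mul_of_nonneg_left h1 (by linarith)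
    · have hPp : (P : ℝ) ≤ p := by exact_mod_cast not_lt.mp h
      have h2 : (2 : ℝ) ≤ (p : ℝ) ^ ε := by
        calc (2 : ℝ) = ((2 : ℝ) ^ (1 / ε)) ^ ε := by
              rw [← Real.rpow_mul (by norm_num), one_div_mul_cancel hε.ne', Real.rpow_one]
          _ ≤ _ := Real.rpow_le_rpow (by positivity) (hP.trans hPp) hε.le
      have h3 : 1 + (a : ℝ) * 1 ≤ (1 + 1) ^ a := one_add_mul_le_pow (by norm_num) a
      have h4 : ((1 : ℝ) + 1) ^ a ≤ ((p : ℝ) ^ ε) ^ a :=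
        pow_le_pow_left₀ (by norm_num) (by linarith) a
      linarith
  rw [Nat.card_divisors hn.ne']
  push_cast
  have hnn : (n : ℝ) ^ ε = ∏ p ∈ n.primeFactors, ((p : ℝ) ^ n.factorization p) ^ ε := by
    rw [Real.finsetProd_rpow _ _ (fun i _ => by positivity)]
    congr 1
    conv_lhs => rw [← Nat.prod_factorization_pow_eq_self hn.ne']
    rw [Finsupp.prod]
    push_cast
    rfl
  calc _ ≤ ∏ p ∈ n.primeFactors, (if p < P then K else 1) * ((p : ℝ) ^ n.factorization p) ^ ε :=
        Finset.prod_le_prod (fun _ _ => by positivity) (fun p hp => by exact_mod_cast key p hp)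
    _ = (∏ p ∈ n.primeFactors, (if p < P then K else 1)) * (n : ℝ) ^ ε := by
        rw [Finset.prod_mul_distrib, hnn]
    _ ≤ _ := by
        apply mul_le_mul_of_nonneg_right _ (by positivity)
        rw [← Finset.prod_filter, Finset.prod_const]
        apply pow_le_pow_right₀ hK1
        calc _ ≤ (Finset.range P).card := by
              apply Finset.card_le_card
              intro p hp
              simp at hp ⊢
              exact hp.2
          _ = P := by simp

theorem count_prim (D N : ℕ) (hD : 0 < D) (hN : 0 < N)
    (h : ∀ p : ℕ, p.Prime → p ^ 2 ∣ N → ¬ p ^ 2 ∣ D) (T : Finset (ℤ × ℤ))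
    (hT : ∀ t ∈ T, t.1 ^ 2 + D * t.2 ^ 2 = N ∧ IsCoprime t.1 t.2) :
    T.card ≤ 25 * N.divisors.card := by
  rcases T.eq_empty_or_nonempty with rfl | ⟨⟨u0, v0⟩, h0⟩
  · simp
  obtain ⟨e0, c0⟩ := hT _ h0
  simp only at e0 c0
  have hNZ : (0 : ℤ) < N := by exact_mod_cast hN
  have hDZ : (0 : ℤ) < D := by exact_mod_cast hD
  have cN : IsCoprime (N : ℤ) v0 := by
    rw [← e0]
    have : (u0 ^ 2 + D * v0 ^ 2) = u0 ^ 2 + v0 * (D * v0) := by ring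
    rw [this]
    exact IsCoprime.add_mul_left_left (IsCoprime.pow_left c0) _
  apply Finset.card_le_mul_card_image_of_maps_to
    (f := fun t : ℤ × ℤ => Int.gcd N (t.1 * v0 - u0 * t.2))
  · intro t ht
    rw [Nat.mem_divisors]
    refine ⟨?_, hN.ne'⟩
    have := Int.gcd_dvd_left (N : ℤ) (t.1 * v0 - u0 * t.2)
    exact_mod_cast this
  intro d hd
  obtain ⟨⟨e, hde⟩, -⟩ := Nat.mem_divisors.mp hd
  have hdeZ : (N : ℤ) = d * e := by exact_mod_cast hde
  have hd0 : (d : ℤ) ≠ 0 := by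
    rintro h
    rw [h] at hdeZ; simp at hdeZ; omega
  have A : ∀ t ∈ T.filter (fun t : ℤ × ℤ => Int.gcd N (t.1 * v0 - u0 * t.2) = d),
      t.1 ^ 2 + D * t.2 ^ 2 = N ∧ (d : ℤ) ∣ t.1 * v0 - u0 * t.2 ∧
      (e : ℤ) ∣ t.1 * v0 + u0 * t.2 := by
    rintro ⟨u, v⟩ ht
    rw [Finset.mem_filter] at ht
    obtain ⟨htT, hg⟩ := ht
    simp only at hg ⊢
    have he := (hT _ htT).1
    simp only at he
    have hdw : (d : ℤ) ∣ u * v0 - u0 * v := by rw [← hg]; exact Int.gcd_dvd_right _ _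
    refine ⟨he, hdw, ?_⟩
    obtain ⟨w, hw⟩ := hdw
    have hce : IsCoprime (e : ℤ) w := by
      rw [Int.isCoprime_iff_gcd_eq_one]
      rw [hw, hdeZ, Int.gcd_mul_left] at hg
      have hd' : 0 < d := by
        rcases Nat.eq_zero_or_pos d with h | h
        · simp [h] at hd0
        · exact h
      simp only [Int.natAbs_natCast] at hg
      exact Nat.eq_of_mul_eq_mul_left hd' (by simpa using hg)
    apply hce.dvd_of_dvd_mul_left
    refine ⟨v0 ^ 2 - v ^ 2, ?_⟩
    apply mul_left_cancel₀ hd0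
    have : (u * v0 - u0 * v) * (u * v0 + u0 * v) = N * (v0 ^ 2 - v ^ 2) := by
      linear_combination v0 ^ 2 * he - v ^ 2 * e0
    rw [hw, hdeZ] at this
    linear_combination this
  set F := T.filter (fun t : ℤ × ℤ => Int.gcd N (t.1 * v0 - u0 * t.2) = d)
  rcases F.eq_empty_or_nonempty with hF | ⟨⟨u', v'⟩, h'⟩
  · simp [hF]
  obtain ⟨e', d', f'⟩ := A _ h'
  simp only at e' d' f'
  have c' : IsCoprime u' v' := (hT _ (Finset.mem_filter.mp h').1).2
  have hg2 : Nat.gcd d e ∣ 2 := by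
    set g := Nat.gcd d e with hg
    have gd : (g : ℤ) ∣ d := by exact_mod_cast Nat.gcd_dvd_left d e
    have ge : (g : ℤ) ∣ e := by exact_mod_cast Nat.gcd_dvd_right d e
    have g1 : (g : ℤ) ∣ 2 * u' * v0 := by
      have := dvd_add (gd.trans d') (ge.trans f')
      have h2 : u' * v0 - u0 * v' + (u' * v0 + u0 * v') = 2 * u' * v0 := by ring
      rwa [h2] at this
    have gN : (g : ℤ) ∣ N := gd.trans ⟨e, hdeZ⟩
    have g2 : (g : ℤ) ∣ 2 * u' := (cN.of_isCoprime_of_dvd_left gN).dvd_of_dvd_mul_right g1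
    have gc : IsCoprime (g : ℤ) u' := by
      rw [Int.isCoprime_iff_gcd_eq_one]
      by_contra hne
      obtain ⟨p, hp, hpg⟩ := Nat.exists_prime_and_dvd hne
      have hpg' : (p : ℤ) ∣ g := (Int.natCast_dvd_natCast.mpr hpg).trans (Int.gcd_dvd_left _ _)
      have hpu : (p : ℤ) ∣ u' := (Int.natCast_dvd_natCast.mpr hpg).trans (Int.gcd_dvd_right _ _)
      have hpN : (p : ℤ) ^ 2 ∣ N := by
        rw [hdeZ, sq]
        exact mul_dvd_mul (hpg'.trans gd) (hpg'.trans ge)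
      apply h p hp (by exact_mod_cast hpN)
      have h3 : (p : ℤ) ^ 2 ∣ D * v' ^ 2 := by
        have : (D * v' ^ 2 : ℤ) = N - u' ^ 2 := by linarith
        rw [this]
        exact dvd_sub hpN (pow_dvd_pow_of_dvd hpu 2)
      have h4 : IsCoprime ((p : ℤ) ^ 2) (v' ^ 2) :=
        (c'.of_isCoprime_of_dvd_left hpu).pow
      exact_mod_cast h4.dvd_of_dvd_mul_right h3
    exact_mod_cast gc.dvd_of_dvd_mul_right g2
  have hdvd : ∀ t ∈ F, (N : ℤ) ∣ 2 * (t.1 * v' - u' * t.2) := by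
    rintro ⟨u, v⟩ ht
    obtain ⟨he, hd1, he1⟩ := A _ ht
    simp only at he hd1 he1 ⊢
    have hdZ : (d : ℤ) ∣ u * v' - u' * v := by
      apply (cN.of_isCoprime_of_dvd_left ⟨e, hdeZ⟩).dvd_of_dvd_mul_left
      have : v0 * (u * v' - u' * v) = v' * (u * v0 - u0 * v) - v * (u' * v0 - u0 * v') := by ring
      rw [this]
      exact dvd_sub (hd1.mul_left _) (d'.mul_left _)
    have heZ : (e : ℤ) ∣ u * v' - u' * v := by
      apply (cN.of_isCoprime_of_dvd_left ⟨d, by rw [hdeZ, mul_comm]⟩).dvd_of_dvd_mul_left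
      have : v0 * (u * v' - u' * v) = v' * (u * v0 + u0 * v) - v * (u' * v0 + u0 * v') := by ring
      rw [this]
      exact dvd_sub (he1.mul_left _) (f'.mul_left _)
    have hl : (N : ℤ) ∣ (Nat.gcd d e : ℕ) * (u * v' - u' * v) := by
      have h1 : ((Nat.lcm d e : ℕ) : ℤ) ∣ u * v' - u' * v := by
        rw [Int.natCast_dvd] at hdZ heZ ⊢
        exact Nat.lcm_dvd hdZ heZ
      have h2 : (N : ℤ) = (Nat.gcd d e : ℕ) * (Nat.lcm d e : ℕ) := by
        rw [hdeZ]; exact_mod_cast (Nat.gcd_mul_lcm d e).symm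
      rw [h2]
      exact mul_dvd_mul_left _ h1
    exact hl.trans (mul_dvd_mul_right (by exact_mod_cast hg2) _)
  have hdvd2 : ∀ t ∈ F, (N : ℤ) ∣ 2 * (t.1 * u' + D * t.2 * v') := by
    intro t ht
    have h1 := (A _ ht).1
    have h2 := hdvd t ht
    rw [← Int.pow_dvd_pow_iff (n := 2) (by norm_num)] at h2 ⊢
    have : (2 * (t.1 * u' + D * t.2 * v')) ^ 2 =
        (N : ℤ) ^ 2 * 4 - D * (2 * (t.1 * v' - u' * t.2)) ^ 2 := by
      have : (N : ℤ) ^ 2 = (t.1 ^ 2 + D * t.2 ^ 2) * (u' ^ 2 + D * v' ^ 2) := by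
        rw [h1, e', sq]
      rw [this]; ring
    rw [this]
    exact dvd_sub (dvd_mul_right _ _) (h2.mul_left _)
  have hcard : ((Finset.Icc (-2 : ℤ) 2) ×ˢ (Finset.Icc (-2 : ℤ) 2)).card = 25 := by
    rfl
  rw [← hcard]
  apply Finset.card_le_card_of_injOn (fun t : ℤ × ℤ =>
    ((2 * (t.1 * u' + D * t.2 * v')) / (N : ℤ), (2 * (t.1 * v' - u' * t.2)) / (N : ℤ)))
  · intro t ht
    obtain ⟨X, hX⟩ := hdvd2 t ht
    obtain ⟨Y, hY⟩ := hdvd t ht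
    have h1 := (A _ ht).1
    simp only [hX, hY, Int.mul_ediv_cancel_left _ hNZ.ne']
    have h4 : X ^ 2 + D * Y ^ 2 = 4 := by
      have hN2 : (N : ℤ) ^ 2 ≠ 0 := by positivity
      apply mul_left_cancel₀ hN2
      have : (N : ℤ) ^ 2 = (t.1 ^ 2 + D * t.2 ^ 2) * (u' ^ 2 + D * v' ^ 2) := by
        rw [h1, e', sq]
      calc (N : ℤ) ^ 2 * (X ^ 2 + D * Y ^ 2) = (N * X) ^ 2 + D * (N * Y) ^ 2 := by ring
        _ = _ := by rw [← hX, ← hY, this]; ring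
    have hX2 : X ^ 2 ≤ 4 := by nlinarith [sq_nonneg Y]
    have hY2 : Y ^ 2 ≤ 4 := by nlinarith [sq_nonneg X, sq_nonneg Y]
    simp only [Finset.coe_product, Set.mem_prod, Finset.coe_Icc, Set.mem_Icc]
    refine ⟨⟨?_, ?_⟩, ⟨?_, ?_⟩⟩ <;> nlinarith
  · intro t ht t2 ht2 heq
    simp only [Prod.mk.injEq] at heq
    have h1 := (Int.ediv_left_inj (hdvd2 t ht) (hdvd2 t2 ht2)).mp heq.1
    have h2 := (Int.ediv_left_inj (hdvd t ht) (hdvd t2 ht2)).mp heq.2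
    ext
    · apply mul_left_cancel₀ (mul_ne_zero two_ne_zero hNZ.ne')
      rw [← e']
      linear_combination u' * h1 + D * v' * h2
    · apply mul_left_cancel₀ (mul_ne_zero two_ne_zero hNZ.ne')
      rw [← e']
      linear_combination v' * h1 - u' * h2

theorem divisors_card_le {a b : ℕ} (h : a ∣ b) (hb : 0 < b) :
    a.divisors.card ≤ b.divisors.card :=
  Finset.card_le_card (Nat.divisors_subset_of_dvd hb.ne' h)

theorem count_red (D N : ℕ) (hD : 0 < D) (hN : 0 < N)
    (h : ∀ p : ℕ, p.Prime → p ^ 2 ∣ N → ¬ p ^ 2 ∣ D) (T : Finset (ℤ × ℤ))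
    (hT : ∀ t ∈ T, t.1 ^ 2 + D * t.2 ^ 2 = N) :
    T.card ≤ 25 * N.divisors.card * N.divisors.card := by
  have hNZ : (0 : ℤ) < N := by exact_mod_cast hN
  have sqd : ∀ t ∈ T, (Int.gcd t.1 t.2) ^ 2 ∣ N := by
    intro t ht
    have h1 : ((Int.gcd t.1 t.2 : ℕ) : ℤ) ∣ t.1 := Int.gcd_dvd_left _ _
    have h2 : ((Int.gcd t.1 t.2 : ℕ) : ℤ) ∣ t.2 := Int.gcd_dvd_right _ _
    have : ((Int.gcd t.1 t.2 : ℕ) : ℤ) ^ 2 ∣ N := by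
      rw [← hT t ht]
      exact dvd_add (pow_dvd_pow_of_dvd h1 2) ((pow_dvd_pow_of_dvd h2 2).mul_left _)
    exact_mod_cast this
  apply Finset.card_le_mul_card_image_of_maps_to (f := fun t : ℤ × ℤ => Int.gcd t.1 t.2)
  · intro t ht
    rw [Nat.mem_divisors]
    exact ⟨(dvd_pow_self _ two_ne_zero).trans (sqd t ht), hN.ne'⟩
  intro g hg
  rcases (T.filter (fun t : ℤ × ℤ => Int.gcd t.1 t.2 = g)).eq_empty_or_nonempty with hF | ⟨t0, ht0⟩
  · rw [hF]; simp
  obtain ⟨N', hN'⟩ : g ^ 2 ∣ N := by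
    have := Finset.mem_filter.mp ht0
    rw [← this.2]; exact sqd _ this.1
  have hN'0 : 0 < N' := Nat.pos_of_ne_zero (by rintro rfl; omega)
  have hg0 : 0 < g := Nat.pos_of_ne_zero (by rintro rfl; simp at hN'; omega)
  have hgZ : (g : ℤ) ≠ 0 := by exact_mod_cast hg0.ne'
  have hd : ∀ t ∈ T.filter (fun t : ℤ × ℤ => Int.gcd t.1 t.2 = g),
      ∃ a b : ℤ, t = (g * a, g * b) ∧ IsCoprime a b ∧ a ^ 2 + D * b ^ 2 = N' := by
    rintro ⟨u, v⟩ ht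
    obtain ⟨htT, hgt⟩ := Finset.mem_filter.mp ht
    simp only at hgt
    have h1 : (g : ℤ) ∣ u := by rw [← hgt]; exact Int.gcd_dvd_left _ _
    have h2 : (g : ℤ) ∣ v := by rw [← hgt]; exact Int.gcd_dvd_right _ _
    obtain ⟨a, rfl⟩ := h1
    obtain ⟨b, rfl⟩ := h2
    refine ⟨a, b, rfl, ?_, ?_⟩
    · rw [Int.isCoprime_iff_gcd_eq_one]
      rw [Int.gcd_mul_left] at hgt
      exact Nat.eq_of_mul_eq_mul_left hg0 (by simpa using hgt)
    · have := hT _ htT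
      simp only [hN'] at this
      apply mul_left_cancel₀ (pow_ne_zero 2 hgZ)
      push_cast at this
      linear_combination this
  calc _ = ((T.filter (fun t : ℤ × ℤ => Int.gcd t.1 t.2 = g)).image
        (fun t : ℤ × ℤ => (t.1 / (g : ℤ), t.2 / (g : ℤ)))).card := by
        rw [Finset.card_image_of_injOn]
        intro t ht t2 ht2 heq
        obtain ⟨a, b, rfl, -, -⟩ := hd _ ht
        obtain ⟨a2, b2, rfl, -, -⟩ := hd _ ht2
        simp only [Int.mul_ediv_cancel_left _ hgZ, Prod.mk.injEq] at heq
        rw [heq.1, heq.2]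
    _ ≤ 25 * N'.divisors.card := by
        apply count_prim D N' hD hN'0
        · intro p hp h1 h2
          exact h p hp (h1.trans ⟨g ^ 2, by rw [hN', mul_comm]⟩) h2
        · intro t ht
          obtain ⟨t', ht', rfl⟩ := Finset.mem_image.mp ht
          obtain ⟨a, b, rfl, h1, h2⟩ := hd _ ht'
          simp only [Int.mul_ediv_cancel_left _ hgZ]
          exact ⟨h2, h1⟩
    _ ≤ _ := Nat.mul_le_mul_left _ (divisors_card_le ⟨g ^ 2, by rw [hN', mul_comm]⟩ hN)

theorem count_full (N : ℕ) : ∀ D : ℕ, 0 < D → 0 < N → ∀ T : Finset (ℤ × ℤ),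
    (∀ t ∈ T, t.1 ^ 2 + D * t.2 ^ 2 = N) →
    T.card ≤ 25 * N.divisors.card * N.divisors.card := by
  induction N using Nat.strong_induction_on with
  | _ N ih =>
  intro D hD hN T hT
  by_cases h : ∀ p : ℕ, p.Prime → p ^ 2 ∣ N → ¬ p ^ 2 ∣ D
  · exact count_red D N hD hN h T hT
  push Not at h
  obtain ⟨p, hp, ⟨N', hN'⟩, ⟨D', hD'⟩⟩ := h
  have hN'0 : 0 < N' := Nat.pos_of_ne_zero (by rintro rfl; omega)
  have hD'0 : 0 < D' := Nat.pos_of_ne_zero (by rintro rfl; omega)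
  have hpZ : (p : ℤ) ≠ 0 := by exact_mod_cast hp.ne_zero
  have hlt : N' < N := by
    have h2 := hp.two_le
    have h4 : 4 ≤ p ^ 2 := by nlinarith
    nlinarith
  have hd : ∀ t ∈ T, ∃ a : ℤ, t.1 = p * a ∧ a ^ 2 + D' * t.2 ^ 2 = N' := by
    intro t ht
    have := hT t ht
    rw [hN', hD'] at this
    push_cast at this
    have h1 : (p : ℤ) ^ 2 ∣ t.1 ^ 2 := ⟨N' - D' * t.2 ^ 2, by linear_combination this⟩
    rw [Int.pow_dvd_pow_iff (by norm_num)] at h1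
    obtain ⟨a, ha⟩ := h1
    refine ⟨a, ha, ?_⟩
    apply mul_left_cancel₀ (pow_ne_zero 2 hpZ)
    rw [ha] at this
    linear_combination this
  calc _ = (T.image (fun t : ℤ × ℤ => (t.1 / (p : ℤ), t.2))).card := by
        rw [Finset.card_image_of_injOn]
        intro t ht t2 ht2 heq
        obtain ⟨a, h1, -⟩ := hd _ ht
        obtain ⟨a2, h2, -⟩ := hd _ ht2
        simp only [h1, h2, Int.mul_ediv_cancel_left _ hpZ, Prod.mk.injEq] at heq
        ext
        · rw [h1, h2, heq.1]
        · exact heq.2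
    _ ≤ 25 * N'.divisors.card * N'.divisors.card := by
        apply ih N' hlt D' hD'0 hN'0
        intro t ht
        obtain ⟨t', ht', rfl⟩ := Finset.mem_image.mp ht
        obtain ⟨a, h1, h2⟩ := hd _ ht'
        simp only [h1, Int.mul_ediv_cancel_left _ hpZ]
        exact h2
    _ ≤ _ := by
        have := divisors_card_le (a := N') (b := N) ⟨p ^ 2, by rw [hN', mul_comm]⟩ hN
        gcongr

theorem geo_count (ε : ℝ) (hε : 0 < ε) : ∃ C : ℝ, 1 ≤ C ∧ ∀ m : ℕ, 0 < m →
    ∀ p q r : ℤ, r ≠ 0 → ∀ T : Finset (ℤ × ℤ × ℤ),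
    (∀ t ∈ T, t.1 ^ 2 + t.2.1 ^ 2 + t.2.2 ^ 2 = m ∧
      (p - t.1) ^ 2 + (q - t.2.1) ^ 2 + (r - t.2.2) ^ 2 = m) →
    (T.card : ℝ) ≤ C * (m : ℝ) ^ ε := by
  obtain ⟨C0, hC0, hdiv⟩ := divisor_bound (ε / 6) (by positivity)
  have h64 : (1 : ℝ) ≤ ((64 : ℝ) ^ (ε / 6)) ^ 2 :=
    one_le_pow₀ (Real.one_le_rpow (by norm_num) (by positivity))
  have hC1 : (1 : ℝ) ≤ 25 * C0 ^ 2 * ((64 : ℝ) ^ (ε / 6)) ^ 2 := by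
    have : (1 : ℝ) ≤ C0 ^ 2 := one_le_pow₀ hC0
    nlinarith
  refine ⟨25 * C0 ^ 2 * ((64 : ℝ) ^ (ε / 6)) ^ 2, hC1, ?_⟩
  intro m hm p q r hr T hT
  have hm1 : (1 : ℝ) ≤ m := by exact_mod_cast hm
  have hmε : (1 : ℝ) ≤ (m : ℝ) ^ ε := Real.one_le_rpow hm1 hε.le
  have hr2 : 0 < r ^ 2 := by positivity
  have horth : ∀ t ∈ T, p * (2 * t.1 - p) + q * (2 * t.2.1 - q) + r * (2 * t.2.2 - r) = 0 := by
    intro t ht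
    obtain ⟨h1, h2⟩ := hT t ht
    linear_combination h1 - h2
  have hnorm : ∀ t ∈ T, (2 * t.1 - p) ^ 2 + (2 * t.2.1 - q) ^ 2 + (2 * t.2.2 - r) ^ 2 =
      4 * m - (p ^ 2 + q ^ 2 + r ^ 2) := by
    intro t ht
    obtain ⟨h1, h2⟩ := hT t ht
    linear_combination 2 * h1 + 2 * h2
  rcases T.eq_empty_or_nonempty with rfl | ⟨t0, ht0⟩
  · simp; positivity
  set M : ℤ := 4 * m - (p ^ 2 + q ^ 2 + r ^ 2) with hM
  have hM0 : 0 ≤ M := by rw [← hnorm t0 ht0]; positivity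
  rcases hM0.eq_or_lt with hM0 | hM0
  · have : T.card ≤ 1 := by
      rw [Finset.card_le_one]
      have hz : ∀ t ∈ T, 2 * t.1 - p = 0 ∧ 2 * t.2.1 - q = 0 ∧ 2 * t.2.2 - r = 0 := by
        intro t ht
        have := hnorm t ht
        rw [← hM0] at this
        refine ⟨?_, ?_, ?_⟩ <;> rw [← sq_eq_zero_iff] <;>
          nlinarith [sq_nonneg (2 * t.1 - p), sq_nonneg (2 * t.2.1 - q), sq_nonneg (2 * t.2.2 - r)]
      intro a ha b hb
      obtain ⟨h1, h2, h3⟩ := hz a ha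
      obtain ⟨h4, h5, h6⟩ := hz b hb
      ext <;> omega
    have : (T.card : ℝ) ≤ 1 := by exact_mod_cast this
    nlinarith
  set a : ℤ := r ^ 2 + p ^ 2 with ha
  have ha0 : 0 < a := by positivity
  have hN0 : 0 < a * M * r ^ 2 := by positivity
  obtain ⟨N, hN⟩ := Int.eq_ofNat_of_zero_le hN0.le
  obtain ⟨D, hD⟩ := Int.eq_ofNat_of_zero_le (show 0 ≤ p ^ 2 + q ^ 2 + r ^ 2 by positivity)
  have hNpos : 0 < N := by omega
  have hDpos : 0 < D := by
    have : 0 < p ^ 2 + q ^ 2 + r ^ 2 := by positivity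
    omega
  have hcard : T.card ≤ 25 * N.divisors.card * N.divisors.card := by
    calc T.card = (T.image (fun t : ℤ × ℤ × ℤ => (a * (2 * t.1 - p) + p * q * (2 * t.2.1 - q),
          r * (2 * t.2.1 - q)))).card := by
          rw [Finset.card_image_of_injOn]
          intro t ht t2 ht2 heq
          simp only [Prod.mk.injEq] at heq
          have h2 : t.2.1 = t2.2.1 := by
            have := mul_left_cancel₀ hr heq.2
            omega
          have h1 : t.1 = t2.1 := by
            have h := heq.1
            rw [h2] at h
            have := mul_left_cancel₀ ha0.ne' (add_right_cancel h)
            omega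
          have h3 : t.2.2 = t2.2.2 := by
            have e1 := horth t ht
            have e2 := horth t2 ht2
            rw [h1, h2, ← e2] at e1
            have := mul_left_cancel₀ hr (add_left_cancel e1)
            omega
          ext <;> assumption
      _ ≤ _ := by
          apply count_full N D hDpos hNpos
          intro t ht
          obtain ⟨t', ht', rfl⟩ := Finset.mem_image.mp ht
          have e1 := horth t' ht'
          have e2 := hnorm t' ht'
          simp only
          have hN' : (N : ℤ) = a * M * r ^ 2 := hN.symm
          have hD' : (D : ℤ) = p ^ 2 + q ^ 2 + r ^ 2 := hD.symm
          rw [hN', hD', ← e2, ha]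
          generalize 2 * t'.1 - p = y1 at *
          generalize 2 * t'.2.1 - q = y2 at *
          generalize 2 * t'.2.2 - r = y3 at *
          have e3 : r * y3 = -(p * y1 + q * y2) := by linarith
          have e4 : (r * y3) ^ 2 = (p * y1 + q * y2) ^ 2 := by rw [e3]; ring
          linear_combination (-(r ^ 2 + p ^ 2)) * e4
  have hNle : (N : ℝ) ≤ 64 * (m : ℝ) ^ 3 := by
    have hb1 : a ≤ 4 * m := by nlinarith [sq_nonneg q]
    have hb2 : M ≤ 4 * m := by nlinarith [sq_nonneg q, sq_nonneg p]
    have hb3 : r ^ 2 ≤ 4 * m := by nlinarith [sq_nonneg q, sq_nonneg p]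
    have : (N : ℤ) ≤ 64 * (m : ℤ) ^ 3 := by
      calc (N : ℤ) = a * M * r ^ 2 := hN.symm
        _ ≤ (4 * m) * (4 * m) * (4 * m) := by gcongr
        _ = _ := by ring
    exact_mod_cast this
  have hd1 : (N.divisors.card : ℝ) ≤ C0 * ((64 : ℝ) ^ (ε / 6) * ((m : ℝ) ^ 3) ^ (ε / 6)) := by
    refine (hdiv N hNpos).trans ?_
    rw [← Real.mul_rpow (by norm_num) (by positivity)]
    gcongr
  have hpow : (((m : ℝ) ^ 3) ^ (ε / 6)) ^ 2 = (m : ℝ) ^ ε := by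
    rw [← Real.rpow_natCast, ← Real.rpow_natCast, ← Real.rpow_mul (by positivity),
      ← Real.rpow_mul (by positivity)]
    congr 1
    push_cast
    ring
  calc (T.card : ℝ) ≤ 25 * (N.divisors.card : ℝ) ^ 2 := by
        rw [sq, ← mul_assoc]; exact_mod_cast hcard
    _ ≤ 25 * (C0 * ((64 : ℝ) ^ (ε / 6) * ((m : ℝ) ^ 3) ^ (ε / 6))) ^ 2 := by gcongr
    _ = 25 * C0 ^ 2 * ((64 : ℝ) ^ (ε / 6)) ^ 2 * (((m : ℝ) ^ 3) ^ (ε / 6)) ^ 2 := by ring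
    _ = _ := by rw [hpow]

theorem geo_count3 (ε : ℝ) (hε : 0 < ε) : ∃ C : ℝ, 1 ≤ C ∧ ∀ m : ℕ, 0 < m →
    ∀ n : Fin 3 → ℤ, n ≠ 0 → ∀ T : Finset (Fin 3 → ℤ),
    (∀ t ∈ T, t ∈ latSphere 3 m ∧ n - t ∈ latSphere 3 m) →
    (T.card : ℝ) ≤ C * (m : ℝ) ^ ε := by
  obtain ⟨C, hC, h⟩ := geo_count ε hε
  refine ⟨C, hC, ?_⟩
  intro m hm n hn T hT
  simp only [latSphere, Set.mem_ofPred_eq, Fin.sum_univ_three, Pi.sub_apply] at hT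
  have key : ∀ i j k : Fin 3, n k ≠ 0 → (∀ x y : Fin 3 → ℤ, x i = y i → x j = y j → x k = y k →
      x = y) → (∀ t ∈ T, t i ^ 2 + t j ^ 2 + t k ^ 2 = m ∧
      (n i - t i) ^ 2 + (n j - t j) ^ 2 + (n k - t k) ^ 2 = m) →
      (T.card : ℝ) ≤ C * (m : ℝ) ^ ε := by
    intro i j k hk hinj hT'
    rw [← Finset.card_image_of_injOn (f := fun t : Fin 3 → ℤ => (t i, t j, t k)) (s := T)]
    · apply h m hm (n i) (n j) (n k) hk
      intro t ht
      obtain ⟨t', ht', rfl⟩ := Finset.mem_image.mp ht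
      exact hT' t' ht'
    · intro x _ y _ hxy
      simp only [Prod.mk.injEq] at hxy
      exact hinj x y hxy.1 hxy.2.1 hxy.2.2
  have hex : n 0 ≠ 0 ∨ n 1 ≠ 0 ∨ n 2 ≠ 0 := by
    by_contra hcon
    push Not at hcon
    apply hn
    ext i
    fin_cases i <;> simp [hcon]
  rcases hex with h0 | h0 | h0
  · refine key 1 2 0 h0 (fun x y h1 h2 h3 => ?_) (fun t ht => ?_)
    · ext i; fin_cases i <;> assumption
    · have := hT t ht
      constructor <;> linarith
  · refine key 2 0 1 h0 (fun x y h1 h2 h3 => ?_) (fun t ht => ?_)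
    · ext i; fin_cases i <;> assumption
    · have := hT t ht
      constructor <;> linarith
  · refine key 0 1 2 h0 (fun x y h1 h2 h3 => ?_) (fun t ht => ?_)
    · ext i; fin_cases i <;> assumption
    · have := hT t ht
      constructor <;> linarith

theorem finite_tuples {V : Type*} (s : ℕ) (A : Set V) (hA : A.Finite) :
    Finite {x : Fin s → V // ∀ i, x i ∈ A} :=
  (Set.Finite.pi' (fun _ : Fin s => hA)).to_subtype

theorem finite_rep {V : Type*} [AddCommMonoid V] (s : ℕ) (A : Set V) (hA : A.Finite) (n : V) :
    Finite {x : Fin s → V // (∀ i, x i ∈ A) ∧ ∑ i, x i = n} :=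
  ((Set.Finite.pi' (fun _ : Fin s => hA)).subset (fun _ hx => hx.1)).to_subtype

theorem card_tuples {V : Type*} (s : ℕ) (A : Set V) :
    Nat.card {x : Fin s → V // ∀ i, x i ∈ A} = A.ncard ^ s := by
  rw [Nat.card_congr (Equiv.subtypePiEquivPi (p := fun (_ : Fin s) v => v ∈ A)), Nat.card_pi]
  simp [Set.ncard_def, Nat.card_coe_set_eq]

theorem rep_succ {V : Type*} [AddCommGroup V] (s : ℕ) (A : Set V) (hA : A.Finite) (n : V) :
    repCount (s + 1) A n ≤ ∑ a ∈ hA.toFinset, repCount s A (n - a) := by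
  have := fun a : V => finite_rep s A hA (n - a)
  have e : ∑ a ∈ hA.toFinset, repCount s A (n - a) =
      Nat.card (Σ a : hA.toFinset, {x : Fin s → V // (∀ i, x i ∈ A) ∧ ∑ i, x i = n - a}) := by
    rw [Nat.card_sigma, ← Finset.sum_coe_sort]
    rfl
  rw [e]
  unfold repCount
  apply Nat.card_le_card_of_injective (fun x : {x : Fin (s + 1) → V //
      (∀ i, x i ∈ A) ∧ ∑ i, x i = n} => (⟨⟨x.1 0, hA.mem_toFinset.mpr (x.2.1 0)⟩,
      ⟨fun i => x.1 i.succ, fun i => x.2.1 _, by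
        exact eq_sub_of_add_eq' ((Fin.sum_univ_succ x.1).symm.trans x.2.2)⟩⟩ :
      Σ a : hA.toFinset, {x : Fin s → V // (∀ i, x i ∈ A) ∧ ∑ i, x i = n - a}))
  rintro ⟨x, hx⟩ ⟨y, hy⟩ hxy
  apply Subtype.ext
  have h1 : x 0 = y 0 := congrArg (fun z => (z.1 : V)) hxy
  have h2 : (fun i : Fin s => x i.succ) = (fun i => y i.succ) :=
    congrArg (fun z => (z.2.1 : Fin s → V)) hxy
  ext i
  refine Fin.cases h1 (fun j => congrFun h2 j) i

theorem rep_two_le {V : Type*} [AddCommGroup V] (A : Set V) (hA : A.Finite) (n : V) :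
    repCount 2 A n ≤ A.ncard := by
  have : Finite A := hA.to_subtype
  rw [← Nat.card_coe_set_eq]
  unfold repCount
  apply Nat.card_le_card_of_injective (fun x : {x : Fin 2 → V //
      (∀ i, x i ∈ A) ∧ ∑ i, x i = n} => (⟨x.1 0, x.2.1 0⟩ : A))
  rintro ⟨x, hx1, hx2⟩ ⟨y, hy1, hy2⟩ hxy
  apply Subtype.ext
  have h1 : x 0 = y 0 := congrArg Subtype.val hxy
  rw [Fin.sum_univ_two] at hx2 hy2
  have h2 : x 1 = y 1 := by
    rw [← hy2, h1] at hx2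
    exact add_left_cancel hx2
  ext i
  fin_cases i <;> assumption

theorem rep_two_sphere (ε : ℝ) (hε : 0 < ε) : ∃ C : ℝ, 1 ≤ C ∧ ∀ m : ℕ, 0 < m →
    ∀ A : Set (Fin 3 → ℤ), A.Finite → A ⊆ latSphere 3 m →
    ∀ n : Fin 3 → ℤ, n ≠ 0 → (repCount 2 A n : ℝ) ≤ C * (m : ℝ) ^ ε := by
  classical
  obtain ⟨C, hC, h⟩ := geo_count3 ε hε
  refine ⟨C, hC, ?_⟩
  intro m hm A hA hAS n hn
  refine le_trans ?_ (h m hm n hn (hA.toFinset.filter (fun a => n - a ∈ A)) ?_)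
  · rw [Nat.cast_le]
    unfold repCount
    rw [← Nat.card_eq_finsetCard]
    apply Nat.card_le_card_of_injective (fun x : {x : Fin 2 → (Fin 3 → ℤ) //
      (∀ i, x i ∈ A) ∧ ∑ i, x i = n} => (⟨x.1 0, by
        have h1 := x.2.2
        rw [Fin.sum_univ_two] at h1
        rw [Finset.mem_filter, hA.mem_toFinset]
        refine ⟨x.2.1 0, ?_⟩
        rw [sub_eq_of_eq_add' h1.symm]
        exact x.2.1 1⟩ : (hA.toFinset.filter (fun a => n - a ∈ A))))
    rintro ⟨x, hx1, hx2⟩ ⟨y, hy1, hy2⟩ hxy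
    apply Subtype.ext
    have h1 : x 0 = y 0 := congrArg Subtype.val hxy
    rw [Fin.sum_univ_two] at hx2 hy2
    have h2 : x 1 = y 1 := by
      rw [← hy2, h1] at hx2
      exact add_left_cancel hx2
    funext i
    fin_cases i <;> assumption
  · intro t ht
    rw [Finset.mem_filter, hA.mem_toFinset] at ht
    exact ⟨hAS ht.1, hAS ht.2⟩

theorem energy_eq {V : Type*} [AddCommGroup V] (s : ℕ) (A : Set V) (hA : A.Finite)
    [Fintype {x : Fin s → V // ∀ i, x i ∈ A}] :
    addEnergy s A ≤ ∑ x : {x : Fin s → V // ∀ i, x i ∈ A}, repCount s A (∑ i, x.1 i) := by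
  have := fun a : V => finite_rep s A hA a
  have e : ∑ x : {x : Fin s → V // ∀ i, x i ∈ A}, repCount s A (∑ i, x.1 i) =
      Nat.card (Σ x : {x : Fin s → V // ∀ i, x i ∈ A},
        {y : Fin s → V // (∀ i, y i ∈ A) ∧ ∑ i, y i = ∑ i, x.1 i}) := by
    rw [Nat.card_sigma]
    rfl
  rw [e]
  unfold _root_.addEnergy
  apply Nat.card_le_card_of_injective (fun p : {p : (Fin s → V) × (Fin s → V) //
      (∀ i, p.1 i ∈ A) ∧ (∀ i, p.2 i ∈ A) ∧ ∑ i, p.1 i = ∑ i, p.2 i} =>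
      (⟨⟨p.1.1, p.2.1⟩, ⟨p.1.2, p.2.2.1, p.2.2.2.symm⟩⟩ :
      Σ x : {x : Fin s → V // ∀ i, x i ∈ A},
        {y : Fin s → V // (∀ i, y i ∈ A) ∧ ∑ i, y i = ∑ i, x.1 i}))
  rintro ⟨⟨x, x'⟩, hx⟩ ⟨⟨y, y'⟩, hy⟩ hxy
  apply Subtype.ext
  have h1 : x = y := congrArg (fun z => (z.1.1 : Fin s → V)) hxy
  have h2 : x' = y' := congrArg (fun z => (z.2.1 : Fin s → V)) hxy
  exact Prod.ext h1 h2

/-- the bound for `s ≥ 3`, with the constant from `r_2` -/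
theorem rep_ge_three (A : Set (Fin 3 → ℤ)) (hA : A.Finite) (B : ℝ) (hB : 0 ≤ B)
    (h2 : ∀ n : Fin 3 → ℤ, n ≠ 0 → (repCount 2 A n : ℝ) ≤ B) (k : ℕ) :
    ∀ n : Fin 3 → ℤ, (repCount (k + 3) A n : ℝ) ≤ (B + 1) * (A.ncard : ℝ) ^ (k + 1) := by
  classical
  have hcard : hA.toFinset.card = A.ncard := (Set.ncard_eq_toFinset_card A hA).symm
  induction k with
  | zero =>
    intro n
    have h3 : (repCount 3 A n : ℝ) ≤ ∑ a ∈ hA.toFinset, (repCount 2 A (n - a) : ℝ) := by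
      exact_mod_cast rep_succ 2 A hA n
    calc (repCount (0 + 3) A n : ℝ) ≤ ∑ a ∈ hA.toFinset, (repCount 2 A (n - a) : ℝ) := h3
      _ ≤ ∑ a ∈ hA.toFinset, (B + if a = n then (A.ncard : ℝ) else 0) := by
          apply Finset.sum_le_sum
          intro a _
          split_ifs with h
          · have : (repCount 2 A (n - a) : ℝ) ≤ A.ncard := by exact_mod_cast rep_two_le A hA _
            linarith
          · have := h2 (n - a) (fun h' => h (sub_eq_zero.mp h').symm)
            linarith
      _ ≤ (B + 1) * (A.ncard : ℝ) ^ (0 + 1) := by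
          rw [Finset.sum_add_distrib, Finset.sum_const, hcard, Finset.sum_ite_eq']
          have : (if n ∈ hA.toFinset then (A.ncard : ℝ) else 0) ≤ A.ncard := by
            split_ifs <;> simp
          simp only [nsmul_eq_mul, zero_add, pow_one]
          linarith
  | succ k ih =>
    intro n
    have h3 : (repCount (k + 1 + 3) A n : ℝ) ≤
        ∑ a ∈ hA.toFinset, (repCount (k + 3) A (n - a) : ℝ) := by
      exact_mod_cast rep_succ (k + 3) A hA n
    calc _ ≤ _ := h3
      _ ≤ ∑ a ∈ hA.toFinset, (B + 1) * (A.ncard : ℝ) ^ (k + 1) :=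
          Finset.sum_le_sum (fun a _ => ih _)
      _ = _ := by
          rw [Finset.sum_const, hcard, nsmul_eq_mul]; ring

theorem energy_two (A : Set (Fin 3 → ℤ)) (hA : A.Finite) (B : ℝ) (hB : 0 ≤ B)
    (h2 : ∀ n : Fin 3 → ℤ, n ≠ 0 → (repCount 2 A n : ℝ) ≤ B) :
    (addEnergy 2 A : ℝ) ≤ (B + 1) * (A.ncard : ℝ) ^ 2 := by
  classical
  have := finite_tuples 2 A hA
  have := Fintype.ofFinite {x : Fin 2 → (Fin 3 → ℤ) // ∀ i, x i ∈ A}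
  have h1 : (addEnergy 2 A : ℝ) ≤
      ∑ x : {x : Fin 2 → (Fin 3 → ℤ) // ∀ i, x i ∈ A}, (repCount 2 A (∑ i, x.1 i) : ℝ) := by
    exact_mod_cast energy_eq 2 A hA
  have hz : ((Finset.univ.filter (fun x : {x : Fin 2 → (Fin 3 → ℤ) // ∀ i, x i ∈ A} =>
      ∑ i, x.1 i = 0)).card : ℝ) ≤ A.ncard := by
    have := finite_rep 2 A hA 0
    rw [Nat.cast_le]
    refine le_trans ?_ (rep_two_le A hA 0)
    unfold repCount
    rw [← Fintype.card_subtype, ← Nat.card_eq_fintype_card]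
    apply Nat.card_le_card_of_injective (fun x : {x : {x : Fin 2 → (Fin 3 → ℤ) // ∀ i, x i ∈ A} //
      ∑ i, x.1 i = 0} => (⟨x.1.1, x.1.2, x.2⟩ :
      {x : Fin 2 → (Fin 3 → ℤ) // (∀ i, x i ∈ A) ∧ ∑ i, x i = 0}))
    intro x y hxy
    apply Subtype.ext
    apply Subtype.ext
    simpa using hxy
  calc _ ≤ _ := h1
    _ ≤ ∑ x : {x : Fin 2 → (Fin 3 → ℤ) // ∀ i, x i ∈ A},
        (B + if ∑ i, x.1 i = 0 then (A.ncard : ℝ) else 0) := by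
        apply Finset.sum_le_sum
        intro x _
        split_ifs with h
        · have : (repCount 2 A (∑ i, x.1 i) : ℝ) ≤ A.ncard := by
            exact_mod_cast rep_two_le A hA _
          linarith
        · have := h2 _ h
          linarith
    _ ≤ _ := by
        rw [Finset.sum_add_distrib, Finset.sum_const, ← Finset.sum_filter, Finset.sum_const,
          Finset.card_univ, ← Nat.card_eq_fintype_card, card_tuples]
        simp only [nsmul_eq_mul]
        push_cast
        have : (0 : ℝ) ≤ A.ncard := Nat.cast_nonneg _
        nlinarith

theorem energy_ge_three (A : Set (Fin 3 → ℤ)) (hA : A.Finite) (B : ℝ) (hB : 0 ≤ B)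
    (h2 : ∀ n : Fin 3 → ℤ, n ≠ 0 → (repCount 2 A n : ℝ) ≤ B) (k : ℕ) :
    (addEnergy (k + 2) A : ℝ) ≤ (B + 1) * (A.ncard : ℝ) ^ (2 * k + 2) := by
  rcases k with _ | k
  · exact energy_two A hA B hB h2
  have := finite_tuples (k + 3) A hA
  have := Fintype.ofFinite {x : Fin (k + 3) → (Fin 3 → ℤ) // ∀ i, x i ∈ A}
  have h1 : (addEnergy (k + 3) A : ℝ) ≤
      ∑ x : {x : Fin (k + 3) → (Fin 3 → ℤ) // ∀ i, x i ∈ A},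
        (repCount (k + 3) A (∑ i, x.1 i) : ℝ) := by
    exact_mod_cast energy_eq (k + 3) A hA
  calc _ ≤ _ := h1
    _ ≤ ∑ x : {x : Fin (k + 3) → (Fin 3 → ℤ) // ∀ i, x i ∈ A},
        (B + 1) * (A.ncard : ℝ) ^ (k + 1) :=
        Finset.sum_le_sum (fun x _ => rep_ge_three A hA B hB h2 k _)
    _ = _ := by
        rw [Finset.sum_const, Finset.card_univ, ← Nat.card_eq_fintype_card, card_tuples,
          nsmul_eq_mul]
        push_cast
        ring

theorem statement_14 (ε : ℝ) (hε : 0 < ε) :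
    (∃ C : ℝ, 0 < C ∧
      ∀ m : ℕ, 0 < m → ∀ A : Set (Fin 3 → ℤ), A.Finite → A.Nonempty → A ⊆ latSphere 3 m →
        (∀ n : Fin 3 → ℤ, n ≠ 0 → (repCount 2 A n : ℝ) ≤ C * (m : ℝ) ^ ε) ∧
        (repCount 2 A 0 : ℝ) ≤ (A.ncard : ℝ) ∧
        (repCount 3 A 0 : ℝ) ≤ C * (m : ℝ) ^ ε * (A.ncard : ℝ)) ∧
    (∀ s : ℕ, 3 ≤ s → ∃ C : ℝ, 0 < C ∧
      ∀ m : ℕ, 0 < m → ∀ A : Set (Fin 3 → ℤ), A.Finite → A.Nonempty → A ⊆ latSphere 3 m →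
        (↑(⨆ n : Fin 3 → ℤ, repCount s A n) : ℝ) ≤
          C * (m : ℝ) ^ ε * (A.ncard : ℝ) ^ ((s : ℝ) - 2)) ∧
    (∀ s : ℕ, 2 ≤ s → ∃ C : ℝ, 0 < C ∧
      ∀ m : ℕ, 0 < m → ∀ A : Set (Fin 3 → ℤ), A.Finite → A.Nonempty → A ⊆ latSphere 3 m →
        (addEnergy s A : ℝ) ≤ C * (m : ℝ) ^ ε * (A.ncard : ℝ) ^ (2 * (s : ℝ) - 2)) := by
  obtain ⟨C, hC, h⟩ := rep_two_sphere ε hε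
  have hpos : ∀ m : ℕ, 0 < m → (1 : ℝ) ≤ (m : ℝ) ^ ε := fun m hm =>
    Real.one_le_rpow (by exact_mod_cast hm) hε.le
  refine ⟨⟨C + 1, by linarith, ?_⟩, ?_, ?_⟩
  · intro m hm A hA hne hAS
    have hm1 := hpos m hm
    have hc : (0 : ℝ) ≤ A.ncard := Nat.cast_nonneg _
    refine ⟨fun n hn => (h m hm A hA hAS n hn).trans (by nlinarith), ?_, ?_⟩
    · exact_mod_cast rep_two_le A hA 0
    · refine (rep_ge_three A hA _ (by positivity) (h m hm A hA hAS) 0 0).trans ?_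
      rw [zero_add, pow_one]
      apply mul_le_mul_of_nonneg_right _ hc
      nlinarith
  · intro s hs
    obtain ⟨k, rfl⟩ := Nat.exists_eq_add_of_le' hs
    refine ⟨C + 1, by linarith, ?_⟩
    intro m hm A hA hne hAS
    have hm1 := hpos m hm
    have hc : (0 : ℝ) ≤ A.ncard := Nat.cast_nonneg _
    have e : ((k + 3 : ℕ) : ℝ) - 2 = ((k + 1 : ℕ) : ℝ) := by push_cast; ring
    rw [e, Real.rpow_natCast]
    have hb : ∀ n, (repCount (k + 3) A n : ℝ) ≤
        (C + 1) * (m : ℝ) ^ ε * (A.ncard : ℝ) ^ (k + 1) := by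
      intro n
      refine (rep_ge_three A hA _ (by positivity) (h m hm A hA hAS) k n).trans ?_
      apply mul_le_mul_of_nonneg_right _ (by positivity)
      nlinarith
    have hfl : (⨆ n : Fin 3 → ℤ, repCount (k + 3) A n) ≤
        ⌊(C + 1) * (m : ℝ) ^ ε * (A.ncard : ℝ) ^ (k + 1)⌋₊ :=
      ciSup_le (fun n => Nat.le_floor (hb n))
    exact (Nat.cast_le.mpr hfl).trans (Nat.floor_le (by positivity))
  · intro s hs
    obtain ⟨k, rfl⟩ := Nat.exists_eq_add_of_le' hs
    refine ⟨C + 1, by linarith, ?_⟩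
    intro m hm A hA hne hAS
    have hm1 := hpos m hm
    have e : 2 * ((k + 2 : ℕ) : ℝ) - 2 = ((2 * k + 2 : ℕ) : ℝ) := by push_cast; ring
    rw [e, Real.rpow_natCast]
    refine (energy_ge_three A hA _ (by positivity) (h m hm A hA hAS) k).trans ?_
    apply mul_le_mul_of_nonneg_right _ (by positivity)
    nlinarith
end
end
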